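/- arXiv:1002.3448 — 2 statements merged into one kernel-verified Lean document; each statement's English description precedes it below -/
import Mathlib

section
/- For a probability distribution Q on ℝ^d and x ∈ ℝ^d, define h(Q, x) := sup{ Q(C) : C ⊂ ℝ^d closed and convex with x ∉ interior(C) }. Then x is an interior point of csupp(Q) if and only if h(Q, x) < 1. Moreover, if (Q_n)_n is a sequence of probability distributions on ℝ^d converging weakly to Q, then limsup_{n→∞} h(Q_n, x) ≤ h(Q, x) for every x ∈ ℝ^d. -/
open MeasureTheory Filter Topology Set
open scoped ENNReal RealInnerProductSpace BoundedContinuousFunction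

noncomputable section

/-- Truncation of an extended real number to `ℝ≥0∞`. -/
def EReal.toENN (x : EReal) : ℝ≥0∞ := if x = ⊤ then ⊤ else ENNReal.ofReal x.toReal

/-- The real-valued exponential of an extended real number (`⊤` is sent to `0`,
but this value is never used for functions in the class `Φ`). -/
def EReal.expR (x : EReal) : ℝ := (EReal.exp x).toReal

/-- The class `Φ(d)`: upper semicontinuous, concave functions `φ : E → [-∞, ∞)`
which are coercive in the sense that `φ x → -∞` as `‖x‖ → ∞`. -/
def IsPhi {E : Type*} [NormedAddCommGroup E] [NormedSpace ℝ E] (φ : E → EReal) : Prop :=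
  UpperSemicontinuous φ ∧ (∀ x, φ x ≠ ⊤) ∧
  (∀ x y : E, ∀ a b : ℝ, 0 < a → 0 < b → a + b = 1 →
    (a : EReal) * φ x + (b : EReal) * φ y ≤ φ (a • x + b • y)) ∧
  Tendsto φ (Filter.comap (fun x : E => ‖x‖) atTop) (𝓝 ⊥)

/-- The integral of an `EReal`-valued function with respect to a measure,
defined as the difference of the integrals of the positive and negative parts. -/
def eint {E : Type*} [MeasurableSpace E] (Q : Measure E) (φ : E → EReal) : EReal :=
  ((∫⁻ x, (φ x).toENN ∂Q : ℝ≥0∞) : EReal) - ((∫⁻ x, (-(φ x)).toENN ∂Q : ℝ≥0∞) : EReal)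

/-- The log-likelihood-type functional `L(φ, Q) = ∫ φ dQ - ∫ e^{φ(x)} dx + 1`. -/
def Lfun {E : Type*} [NormedAddCommGroup E] [NormedSpace ℝ E] [MeasureSpace E]
    (φ : E → EReal) (Q : Measure E) : EReal :=
  eint Q φ - ((∫⁻ x, EReal.exp (φ x) : ℝ≥0∞) : EReal) + 1

/-- The profile log-likelihood `L(Q) = sup_{φ ∈ Φ} L(φ, Q)`. -/
def Lprof {E : Type*} [NormedAddCommGroup E] [NormedSpace ℝ E] [MeasureSpace E]
    (Q : Measure E) : EReal :=
  ⨆ φ ∈ {φ : E → EReal | IsPhi φ}, Lfun φ Q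

/-- The convex support of a measure: the intersection of all closed convex sets of full
measure. -/
def csupp {E : Type*} [NormedAddCommGroup E] [NormedSpace ℝ E] [MeasurableSpace E]
    (Q : Measure E) : Set E :=
  ⋂₀ {C : Set E | IsClosed C ∧ Convex ℝ C ∧ Q C = 1}

/-- `ψ` is the (a) maximizer of `L(·, Q)` over `Φ`, i.e. `ψ = ψ(·|Q)`. -/
def IsMLE {E : Type*} [NormedAddCommGroup E] [NormedSpace ℝ E] [MeasureSpace E]
    (Q : Measure E) (ψ : E → EReal) : Prop :=
  IsPhi ψ ∧ ∀ φ : E → EReal, IsPhi φ → Lfun φ Q ≤ Lfun ψ Q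

/-- Weak convergence of a sequence of measures. -/
def WConv {E : Type*} [NormedAddCommGroup E] [MeasurableSpace E]
    (Qn : ℕ → Measure E) (Q : Measure E) : Prop :=
  ∀ g : E →ᵇ ℝ, Tendsto (fun n => ∫ x, g x ∂(Qn n)) atTop (𝓝 (∫ x, g x ∂Q))

/-- The Mallows (Wasserstein-1, Kantorovich–Rubinstein) distance. -/
def D1 {E : Type*} [NormedAddCommGroup E] [MeasurableSpace E] (Q Q' : Measure E) : ℝ :=
  sSup {r : ℝ | ∃ h : E → ℝ, LipschitzWith 1 h ∧ r = |(∫ x, h x ∂Q) - ∫ x, h x ∂Q'|}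

/-- The bounded Lipschitz distance. -/
def DBL (Q Q' : Measure ℝ) : ℝ :=
  sSup {r : ℝ | ∃ h : ℝ → ℝ, (∀ x, |h x| ≤ 1) ∧ LipschitzWith 1 h ∧
    r = |(∫ x, h x ∂Q) - ∫ x, h x ∂Q'|}

/-- The Kolmogorov–Smirnov distance. -/
def DKS (Q Q' : Measure ℝ) : ℝ :=
  ⨆ t : ℝ, |(Q' (Set.Iic t)).toReal - (Q (Set.Iic t)).toReal|

/-- Convolution of two measures. -/
def mconv {E : Type*} [NormedAddCommGroup E] [MeasurableSpace E] (Q R : Measure E) : Measure E :=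
  (Q.prod R).map (fun p => p.1 + p.2)

/-- The empirical measure of a finite tuple of real numbers. -/
def empQ {n : ℕ} (v : Fin n → ℝ) : Measure ℝ :=
  ((n : ℝ≥0∞))⁻¹ • ∑ i, Measure.dirac (v i)

end

/-- `h(Q, x)`: the supremum of `Q(C)` over closed convex sets `C` with `x ∉ interior C`. -/
noncomputable def hdepth {d : ℕ} (Q : Measure (EuclideanSpace ℝ (Fin d)))
    (x : EuclideanSpace ℝ (Fin d)) : ℝ≥0∞ :=
  ⨆ C ∈ {C : Set (EuclideanSpace ℝ (Fin d)) | IsClosed C ∧ Convex ℝ C ∧ x ∉ interior C}, Q C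


/-- closed half space through `x` with outer normal `u`. -/
def halfS {d : ℕ} (x u : EuclideanSpace ℝ (Fin d)) : Set (EuclideanSpace ℝ (Fin d)) :=
  {y | ⟪u, y - x⟫ ≤ 0}

lemma halfS_isClosed {d : ℕ} (x u : EuclideanSpace ℝ (Fin d)) : IsClosed (halfS x u) :=
  isClosed_le (by fun_prop) continuous_const

lemma halfS_convex {d : ℕ} (x u : EuclideanSpace ℝ (Fin d)) : Convex ℝ (halfS x u) := by
  intro y hy z hz a b ha hb hab
  simp only [halfS, Set.mem_ofPred_eq, inner_sub_right, inner_add_right, inner_smul_right] at *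
  have : b = 1 - a := by linarith
  subst this
  nlinarith

lemma halfS_not_interior {d : ℕ} (x u : EuclideanSpace ℝ (Fin d)) (hu : ‖u‖ = 1) :
    x ∉ interior (halfS x u) := by
  intro h
  have h1 : Tendsto (fun t : ℝ => x + t • u) (𝓝[>] 0) (𝓝 x) := by
    have : Continuous (fun t : ℝ => x + t • u) := by fun_prop
    have h2 := this.tendsto 0
    simp only [zero_smul, add_zero] at h2
    exact h2.mono_left nhdsWithin_le_nhds
  have h3 := (h1.eventually (mem_interior_iff_mem_nhds.1 h)).and self_mem_nhdsWithin
  obtain ⟨t, ht, ht0⟩ := h3.exists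
  have ht0 : 0 < t := ht0
  have ht : ⟪u, x + t • u - x⟫ ≤ 0 := ht
  rw [add_sub_cancel_left, inner_smul_right, real_inner_self_eq_norm_sq, hu] at ht
  linarith

lemma exists_halfS_aux {d : ℕ} (x : EuclideanSpace ℝ (Fin d))
    (C : Set (EuclideanSpace ℝ (Fin d)))
    (hx : x ∉ interior C) (hne : C.Nonempty) (hconv : Convex ℝ C) :
    ∃ u : EuclideanSpace ℝ (Fin d), u ≠ 0 ∧ C ⊆ halfS x u := by
  by_cases hi : (interior C).Nonempty
  · obtain ⟨f, hf⟩ := geometric_hahn_banach_open_point hconv.interior isOpen_interior hx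
    obtain ⟨u, rfl⟩ := (InnerProductSpace.toDual ℝ (EuclideanSpace ℝ (Fin d))).surjective f
    simp only [InnerProductSpace.toDual_apply_apply] at hf
    refine ⟨u, ?_, ?_⟩
    · rintro rfl
      obtain ⟨y, hy⟩ := hi
      simpa using hf y hy
    · have h1 : interior C ⊆ halfS x u := fun y hy => by
        have := hf y hy
        simp only [halfS, Set.mem_ofPred_eq, inner_sub_right]
        linarith
      have h2 := closure_minimal h1 (halfS_isClosed x u)
      rw [hconv.closure_interior_eq_closure_of_nonempty_interior hi] at h2
      exact subset_closure.trans h2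
  · rw [hconv.interior_nonempty_iff_affineSpan_eq_top] at hi
    obtain ⟨c, hc⟩ := hne
    have hd : (affineSpan ℝ C).direction ≠ ⊤ := by
      intro h
      exact hi ((AffineSubspace.direction_eq_top_iff_of_nonempty
        ⟨c, subset_affineSpan ℝ C hc⟩).1 h)
    rw [ne_eq, ← Submodule.orthogonal_eq_bot_iff] at hd
    obtain ⟨v, hv, hv0⟩ := Submodule.exists_mem_ne_zero_of_ne_bot hd
    have key : ∀ y ∈ C, ⟪v, y - c⟫ = 0 := fun y hy => by
      have : y -ᵥ c ∈ (affineSpan ℝ C).direction :=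
        AffineSubspace.vsub_mem_direction (subset_affineSpan ℝ C hy) (subset_affineSpan ℝ C hc)
      exact Submodule.inner_left_of_mem_orthogonal this hv
    rcases le_total ⟪v, c - x⟫ 0 with h | h
    · refine ⟨v, hv0, fun y hy => ?_⟩
      have := key y hy
      simp only [halfS, Set.mem_ofPred_eq, inner_sub_right] at *
      linarith
    · refine ⟨-v, neg_ne_zero.2 hv0, fun y hy => ?_⟩
      have := key y hy
      simp only [halfS, Set.mem_ofPred_eq, inner_sub_right, inner_neg_left] at *
      linarith

lemma exists_halfS {d : ℕ} (x : EuclideanSpace ℝ (Fin d))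
    (C : Set (EuclideanSpace ℝ (Fin d)))
    (hx : x ∉ interior C) (hne : C.Nonempty) (hconv : Convex ℝ C) :
    ∃ u : EuclideanSpace ℝ (Fin d), ‖u‖ = 1 ∧ C ⊆ halfS x u := by
  obtain ⟨u, hu, hC⟩ := exists_halfS_aux x C hx hne hconv
  refine ⟨‖u‖⁻¹ • u, ?_, fun y hy => ?_⟩
  · rw [norm_smul, norm_inv, norm_norm, inv_mul_cancel₀ (norm_ne_zero_iff.2 hu)]
  · have h1 : ⟪u, y - x⟫ ≤ 0 := hC hy
    simp only [halfS, Set.mem_ofPred_eq, real_inner_smul_left]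
    exact mul_nonpos_of_nonneg_of_nonpos (by positivity) h1

lemma le_hdepth {d : ℕ} (Q : Measure (EuclideanSpace ℝ (Fin d)))
    (x u : EuclideanSpace ℝ (Fin d)) (hu : ‖u‖ = 1) : Q (halfS x u) ≤ hdepth Q x :=
  le_iSup₂ (f := fun C (_ : C ∈ {C : Set (EuclideanSpace ℝ (Fin d)) |
    IsClosed C ∧ Convex ℝ C ∧ x ∉ interior C}) => Q C) (halfS x u)
    ⟨halfS_isClosed x u, halfS_convex x u, halfS_not_interior x u hu⟩

lemma exists_of_lt_hdepth {d : ℕ} (Q : Measure (EuclideanSpace ℝ (Fin d)))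
    (x : EuclideanSpace ℝ (Fin d)) (r : ℝ≥0∞) (h : r < hdepth Q x) :
    ∃ u : EuclideanSpace ℝ (Fin d), ‖u‖ = 1 ∧ r < Q (halfS x u) := by
  unfold hdepth at h
  simp only [lt_iSup_iff] at h
  obtain ⟨C, ⟨-, h2, h3⟩, hr⟩ := h
  have hne : C.Nonempty := by
    rw [Set.nonempty_iff_ne_empty]
    rintro rfl
    simp at hr
  obtain ⟨u, hu, hC⟩ := exists_halfS x C h3 hne h2
  exact ⟨u, hu, hr.trans_le (measure_mono hC)⟩

lemma limit_halfS {d : ℕ}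
    (Q : Measure (EuclideanSpace ℝ (Fin d))) [IsProbabilityMeasure Q]
    (Qn : ℕ → Measure (EuclideanSpace ℝ (Fin d))) [∀ n, IsProbabilityMeasure (Qn n)]
    (hw : WConv Qn Q) (x : EuclideanSpace ℝ (Fin d)) (v : ℕ → EuclideanSpace ℝ (Fin d))
    (hv : ∀ n, ‖v n‖ = 1) (r : ℕ → ℝ≥0∞) (s : ℝ≥0∞) (hr : Tendsto r atTop (𝓝 s))
    (hle : ∀ n, r n ≤ Qn n (halfS x (v n))) :
    ∃ u : EuclideanSpace ℝ (Fin d), ‖u‖ = 1 ∧ s ≤ Q (halfS x u) := by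
  obtain ⟨u, hu, φ, hφ, hlim⟩ := (isCompact_sphere (0 : EuclideanSpace ℝ (Fin d)) 1).tendsto_subseq
    (x := v) (fun n => by simp [hv n])
  refine ⟨u, by simpa using hu, ?_⟩
  let F : ℝ → Set (EuclideanSpace ℝ (Fin d)) := fun ε => {y | ⟪u, y - x⟫ ≤ ε * ‖y - x‖}
  have hFc : ∀ ε, IsClosed (F ε) := fun ε => isClosed_le (by fun_prop) (by fun_prop)
  let P : ProbabilityMeasure (EuclideanSpace ℝ (Fin d)) := ⟨Q, inferInstance⟩
  let Pn : ℕ → ProbabilityMeasure (EuclideanSpace ℝ (Fin d)) := fun n => ⟨Qn n, inferInstance⟩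
  have hP : Tendsto Pn atTop (𝓝 P) :=
    ProbabilityMeasure.tendsto_iff_forall_integral_tendsto.2 hw
  have hP' : Tendsto (Pn ∘ φ) atTop (𝓝 P) := hP.comp hφ.tendsto_atTop
  have hF : ∀ ε > 0, s ≤ Q (F ε) := by
    intro ε hε
    have h1 : s = limsup (r ∘ φ) atTop := (hr.comp hφ.tendsto_atTop).limsup_eq.symm
    rw [h1]
    refine le_trans ?_ (ProbabilityMeasure.limsup_measure_closed_le_of_tendsto hP' (hFc ε))
    refine limsup_le_limsup ?_
    have h2 : ∀ᶠ n in atTop, dist ((v ∘ φ) n) u < ε := (Metric.tendsto_nhds.1 hlim) ε hε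
    filter_upwards [h2] with n hn
    refine (hle (φ n)).trans (measure_mono ?_)
    intro y hy
    have hy : ⟪v (φ n), y - x⟫ ≤ 0 := hy
    show ⟪u, y - x⟫ ≤ ε * ‖y - x‖
    have h3 : ⟪u - v (φ n), y - x⟫ ≤ ‖u - v (φ n)‖ * ‖y - x‖ := real_inner_le_norm _ _
    rw [inner_sub_left] at h3
    have h4 : ‖u - v (φ n)‖ ≤ ε := by
      rw [← dist_eq_norm, dist_comm]; exact hn.le
    have h5 := mul_le_mul_of_nonneg_right h4 (norm_nonneg (y - x))
    linarith
  have hanti : Antitone (fun n : ℕ => F (1 / ((n : ℝ) + 1))) := by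
    intro m n hmn y hy
    have hy : ⟪u, y - x⟫ ≤ 1 / ((n : ℝ) + 1) * ‖y - x‖ := hy
    show ⟪u, y - x⟫ ≤ 1 / ((m : ℝ) + 1) * ‖y - x‖
    exact hy.trans (mul_le_mul_of_nonneg_right (Nat.one_div_le_one_div hmn) (norm_nonneg _))
  have hint : (⋂ n : ℕ, F (1 / ((n : ℝ) + 1))) ⊆ halfS x u := by
    intro y hy
    rw [Set.mem_iInter] at hy
    have h1 : Tendsto (fun n : ℕ => 1 / ((n : ℝ) + 1) * ‖y - x‖) atTop (𝓝 (0 * ‖y - x‖)) :=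
      tendsto_one_div_add_atTop_nhds_zero_nat.mul_const _
    rw [zero_mul] at h1
    exact ge_of_tendsto' h1 hy
  have ht := tendsto_measure_iInter_atTop (μ := Q)
    (fun n : ℕ => (hFc (1 / ((n : ℝ) + 1))).measurableSet.nullMeasurableSet) hanti
    ⟨0, measure_ne_top _ _⟩
  exact (ge_of_tendsto' ht fun n => hF _ (by positivity)).trans (measure_mono hint)

lemma measure_csupp {d : ℕ} (Q : Measure (EuclideanSpace ℝ (Fin d))) [IsProbabilityMeasure Q] :
    Q (csupp Q) = 1 := by
  have h : Q.support ⊆ csupp Q := by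
    intro y hy C hC
    refine Measure.support_subset_of_isClosed hC.1 ?_ hy
    exact (mem_ae_iff_prob_eq_one hC.1.measurableSet).2 hC.2.2
  have h1 : csupp Q ∈ ae Q := mem_of_superset Measure.support_mem_ae h
  exact prob_compl_eq_zero_iff₀ (NullMeasurableSet.of_compl (NullMeasurableSet.of_null h1)) |>.1 h1

/-- **Lemma 2.** `x` is an interior point of `csupp Q` iff `h(Q, x) < 1`; and `h(·, x)` is
weakly upper semicontinuous along weakly convergent sequences. -/
theorem hdepth_lt_one_iff_and_limsup {d : ℕ}
    (Q : Measure (EuclideanSpace ℝ (Fin d))) [IsProbabilityMeasure Q]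
    (Qn : ℕ → Measure (EuclideanSpace ℝ (Fin d))) [∀ n, IsProbabilityMeasure (Qn n)]
    (hw : WConv Qn Q) :
    (∀ x : EuclideanSpace ℝ (Fin d), x ∈ interior (csupp Q) ↔ hdepth Q x < 1) ∧
    (∀ x : EuclideanSpace ℝ (Fin d),
      Filter.limsup (fun n => hdepth (Qn n) x) atTop ≤ hdepth Q x) := by
  refine ⟨fun x => ⟨fun hx => ?_, fun hx => ?_⟩, fun x => ?_⟩
  · by_contra hlt
    rw [not_lt] at hlt
    obtain ⟨r, -, hr, hr1⟩ := exists_seq_strictMono_tendsto' (show (0 : ℝ≥0∞) < 1 by simp)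
    have hex : ∀ n, ∃ u : EuclideanSpace ℝ (Fin d), ‖u‖ = 1 ∧ r n < Q (halfS x u) :=
      fun n => exists_of_lt_hdepth Q x (r n) ((hr n).2.trans_le hlt)
    choose v hv hvr using hex
    obtain ⟨u, hu, h1⟩ := limit_halfS Q (fun _ => Q) (fun g => tendsto_const_nhds) x v hv r 1 hr1
      (fun n => (hvr n).le)
    refine halfS_not_interior x u hu (interior_mono ?_ hx)
    exact Set.sInter_subset_of_mem ⟨halfS_isClosed x u, halfS_convex x u, le_antisymm prob_le_one h1⟩
  · by_contra hni
    refine hx.not_ge ?_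
    rw [← measure_csupp Q]
    exact le_iSup₂ (f := fun C (_ : C ∈ {C : Set (EuclideanSpace ℝ (Fin d)) |
      IsClosed C ∧ Convex ℝ C ∧ x ∉ interior C}) => Q C) (csupp Q)
      ⟨isClosed_sInter fun C hC => hC.1, convex_sInter fun C hC => hC.2.1, hni⟩
  · refine le_of_forall_lt fun r hr => ?_
    obtain ⟨r', hrr', hr'⟩ := exists_between hr
    obtain ⟨φ, hφ, hlt⟩ := extraction_of_frequently_atTop (frequently_lt_of_lt_limsup (by isBoundedDefault) hr')
    choose v hv hvr using fun n => exists_of_lt_hdepth (Qn (φ n)) x r' (hlt n)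
    obtain ⟨u, hu, h1⟩ := limit_halfS Q (fun n => Qn (φ n))
      (fun g => (hw g).comp hφ.tendsto_atTop) x v hv (fun _ => r') r' tendsto_const_nhds
      (fun n => (hvr n).le)
    exact hrr'.trans_le (h1.trans (le_hdepth Q x u hu))
end

section
/- Let (Q_n)_n be a sequence of probability distributions on ℝ^d, each with convex support having nonempty interior, converging weakly to a distribution Q whose convex support also has nonempty interior. Then limsup_{n→∞} L(Q_n) ≤ L(Q). Moreover, liminf_{n→∞} L(Q_n) < L(Q) if and only if limsup_{n→∞} ∫ ‖x‖ Q_n(dx) > ∫ ‖x‖ Q(dx). -/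
open MeasureTheory Filter Topology Set
open scoped ENNReal RealInnerProductSpace BoundedContinuousFunction

section Aux
open scoped NNReal
variable {d : ℕ}

abbrev Eu (d : ℕ) := EuclideanSpace ℝ (Fin d)


/-- one-sided bound from Levy-Prokhorov, nonneg case -/
lemma lp_bound_nonneg (μ ν : Measure (Eu d)) [IsProbabilityMeasure μ] [IsProbabilityMeasure ν]
    {ε C : ℝ} {Λ : ℝ≥0} (hε : 0 < ε) (hμν : levyProkhorovEDist μ ν < ENNReal.ofReal ε)
    (f : Eu d → ℝ) (hf : LipschitzWith Λ f) (h0 : ∀ x, 0 ≤ f x) (hC : ∀ x, f x ≤ C) :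
    ∫ x, f x ∂μ ≤ ∫ x, f x ∂ν + Λ * ε + ε * C := by
  have hC0 : 0 ≤ C := (h0 0).trans (hC 0)
  have hΛε : 0 ≤ Λ * ε := by positivity
  let F : Eu d →ᵇ ℝ := BoundedContinuousFunction.ofNormedAddCommGroup f hf.continuous C
    (fun x => by rw [Real.norm_eq_abs, abs_of_nonneg (h0 x)]; exact hC x)
  let G : Eu d →ᵇ ℝ := F + BoundedContinuousFunction.const _ (Λ * ε)
  have hF : ∀ x, F x = f x := fun x => rfl
  have hG : ∀ x, G x = f x + Λ * ε := fun x => rfl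
  have hFn : ‖F‖ ≤ C := BoundedContinuousFunction.norm_ofNormedAddCommGroup_le _ hC0 _
  have hFG : ‖F‖ ≤ ‖G‖ := by
    refine (BoundedContinuousFunction.norm_le (norm_nonneg _)).2 fun x => ?_
    refine le_trans ?_ (G.norm_coe_le_norm x)
    rw [hF, hG, Real.norm_eq_abs, Real.norm_eq_abs, abs_of_nonneg (h0 x),
      abs_of_nonneg (add_nonneg (h0 x) hΛε)]
    linarith
  have h1 := BoundedContinuousFunction.integral_le_of_levyProkhorovEDist_lt μ ν hε hμν F
    (Eventually.of_forall fun x => h0 x)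
  have h2 := BoundedContinuousFunction.integral_eq_integral_meas_le G ν
    (Eventually.of_forall fun x => by
      simp only [Pi.zero_apply, hG]; exact add_nonneg (h0 x) hΛε)
  have h3 : ∫ x, G x ∂ν = ∫ x, f x ∂ν + Λ * ε := by
    simp only [hG]
    rw [integral_add (show Integrable f ν from F.integrable ν) (integrable_const _)]
    simp
  have intg : IntegrableOn (fun t ↦ ν.real {a | t ≤ G a}) (Ioc 0 ‖G‖) := by
    apply Measure.integrableOn_of_bounded (M := ν.real univ) measure_Ioc_lt_top.ne
    · apply (Measurable.ennreal_toReal (Antitone.measurable ?_)).aestronglyMeasurable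
      exact fun _ _ hst ↦ measure_mono (fun _ h ↦ hst.trans h)
    · apply Eventually.of_forall <| fun t ↦ ?_
      simp only [Real.norm_eq_abs, abs_of_nonneg measureReal_nonneg]
      exact measureReal_mono (subset_univ _)
  have intf : IntegrableOn (fun t ↦ ν.real (Metric.thickening ε {a | t ≤ F a})) (Ioc 0 ‖F‖) := by
    apply Measure.integrableOn_of_bounded (M := ν.real univ) measure_Ioc_lt_top.ne
    · apply (Measurable.ennreal_toReal (Antitone.measurable ?_)).aestronglyMeasurable
      exact fun _ _ hst ↦ measure_mono <| Metric.thickening_subset_of_subset ε (fun _ h ↦ hst.trans h)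
    · apply Eventually.of_forall <| fun t ↦ ?_
      simp only [Real.norm_eq_abs, abs_of_nonneg measureReal_nonneg]
      exact ENNReal.toReal_mono (by finiteness) <| measure_mono (subset_univ _)
  have h4 : (∫ t in Ioc 0 ‖F‖, ν.real (Metric.thickening ε {a | t ≤ F a}))
      ≤ ∫ t in Ioc 0 ‖F‖, ν.real {a | t ≤ G a} := by
    refine setIntegral_mono intf (intg.mono_set (Ioc_subset_Ioc_right hFG)) fun t => ?_
    refine measureReal_mono ?_
    intro x hx
    obtain ⟨y, hy, hxy⟩ := Metric.mem_thickening_iff.1 hx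
    simp only [mem_ofPred_eq, hF, hG] at hy ⊢
    have := hf.dist_le_mul x y
    rw [Real.dist_eq] at this
    have h5 := (abs_le.1 this).1
    have : Λ * dist x y ≤ Λ * ε := by gcongr
    linarith
  have h5 : (∫ t in Ioc 0 ‖F‖, ν.real {a | t ≤ G a}) ≤ ∫ t in Ioc 0 ‖G‖, ν.real {a | t ≤ G a} := by
    refine setIntegral_mono_set intg (Eventually.of_forall fun t => measureReal_nonneg)
      (Ioc_subset_Ioc_right hFG).eventuallyLE
  have h6 : ε * ‖F‖ ≤ ε * C := by gcongr
  have h7 : ∫ x, F x ∂μ = ∫ x, f x ∂μ := rfl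
  linarith

/-- bundle a probability measure -/
def toPM (Q : Measure (Eu d)) [h : IsProbabilityMeasure Q] : ProbabilityMeasure (Eu d) := ⟨Q, h⟩

lemma WConv.tendsto {Qn : ℕ → Measure (Eu d)} {Q : Measure (Eu d)}
    [∀ n, IsProbabilityMeasure (Qn n)] [IsProbabilityMeasure Q] (hw : WConv Qn Q) :
    Tendsto (fun n => toPM (Qn n)) atTop
      (𝓝 (toPM Q)) :=
  ProbabilityMeasure.tendsto_iff_forall_integral_tendsto.2 hw

/-- Uniform convergence on bounded Lipschitz classes. -/
lemma WConv.uniform_BL {Qn : ℕ → Measure (Eu d)} {Q : Measure (Eu d)}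
    [∀ n, IsProbabilityMeasure (Qn n)] [IsProbabilityMeasure Q] (hw : WConv Qn Q)
    (Λ : ℝ≥0) (C : ℝ) {δ : ℝ} (hδ : 0 < δ) :
    ∀ᶠ n in atTop, ∀ f : Eu d → ℝ, LipschitzWith Λ f → (∀ x, |f x| ≤ C) →
      ∫ x, f x ∂(Qn n) ≤ ∫ x, f x ∂Q + δ := by
  have h1 := (LevyProkhorov.probabilityMeasureHomeomorph (Ω := Eu d)).continuous.tendsto _
    |>.comp hw.tendsto
  obtain ⟨ε, hε, hεδ⟩ : ∃ ε : ℝ, 0 < ε ∧ Λ * ε + ε * (2 * |C|) ≤ δ := by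
    refine ⟨δ / (Λ + 2 * |C| + 1), by positivity, ?_⟩
    have : 0 < (Λ:ℝ) + 2 * |C| + 1 := by positivity
    calc _ = δ * ((Λ + 2 * |C|) / (Λ + 2 * |C| + 1)) := by ring
      _ ≤ δ * 1 := by gcongr; rw [div_le_one this]; linarith
      _ = δ := mul_one _
  have h2 := EMetric.tendsto_nhds.1 h1 (ENNReal.ofReal ε) (by simpa using hε)
  filter_upwards [h2] with n hn f hf hC
  have hC0 : 0 ≤ C := (abs_nonneg _).trans (hC 0)
  have hn' : levyProkhorovEDist (Qn n) Q < ENNReal.ofReal ε := hn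
  have hfi : ∀ (P : Measure (Eu d)) [IsProbabilityMeasure P], Integrable f P := fun P _ =>
    (integrable_const C).mono' hf.continuous.aestronglyMeasurable (Eventually.of_forall hC)
  have := lp_bound_nonneg (Qn n) Q (C := 2 * |C|) (Λ := Λ) hε hn' (fun x => f x + C)
    (by simpa using hf.add (LipschitzWith.const C)) (fun x => by linarith [(abs_le.1 (hC x)).1])
    (fun x => by rw [abs_of_nonneg hC0]; linarith [(abs_le.1 (hC x)).2])
  rw [integral_add (hfi _) (integrable_const _), integral_add (hfi _) (integrable_const _)] at this
  simp at this
  linarith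

/-- lower semicontinuity of integrals of nonneg continuous functions -/
lemma WConv.lsc {Qn : ℕ → Measure (Eu d)} {Q : Measure (Eu d)}
    [∀ n, IsProbabilityMeasure (Qn n)] [IsProbabilityMeasure Q] (hw : WConv Qn Q)
    {f : Eu d → ℝ} (hf : Continuous f) (h0 : 0 ≤ f) :
    ∫⁻ x, ENNReal.ofReal (f x) ∂Q ≤
      atTop.liminf (fun n => ∫⁻ x, ENNReal.ofReal (f x) ∂(Qn n)) := by
  refine lintegral_le_liminf_lintegral_of_forall_isOpen_measure_le_liminf_measure hf h0 ?_
  intro G hG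
  exact ProbabilityMeasure.le_liminf_measure_open_of_tendsto hw.tendsto hG

/-! Basic facts on `Lfun`. -/

lemma toENN_mono {x y : EReal} (h : x ≤ y) : x.toENN ≤ y.toENN := by
  unfold EReal.toENN
  by_cases hy : y = ⊤
  · simp [hy]
  · have hx : x ≠ ⊤ := fun hx => hy (top_le_iff.1 (hx ▸ h))
    rw [if_neg hx, if_neg hy]
    by_cases hx' : x = ⊥
    · simp [hx']
    · exact ENNReal.ofReal_le_ofReal (EReal.toReal_le_toReal h hx' hy)

lemma toENN_coe (r : ℝ) : (r : EReal).toENN = ENNReal.ofReal r := by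
  simp [EReal.toENN]

lemma ereal_coe_ennreal {a : ℝ≥0∞} (h : a ≠ ⊤) : (a : EReal) = ((a.toReal : ℝ) : EReal) := by
  lift a to ℝ≥0 using h
  rfl

lemma eint_coe {Q : Measure (Eu d)} {f : Eu d → ℝ} (hf : Integrable f Q) :
    eint Q (fun x => (f x : EReal)) = ((∫ x, f x ∂Q : ℝ) : EReal) := by
  have h1 : ∫⁻ x, ENNReal.ofReal (f x) ∂Q ≠ ⊤ := hf.lintegral_lt_top.ne
  have h2 : ∫⁻ x, ENNReal.ofReal (-f x) ∂Q ≠ ⊤ := hf.neg.lintegral_lt_top.ne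
  unfold eint
  have h3 : ∀ x, (-(f x : EReal)).toENN = ENNReal.ofReal (- f x) := fun x => by
    rw [← EReal.coe_neg, toENN_coe]
  simp only [toENN_coe, h3]
  rw [integral_eq_lintegral_pos_part_sub_lintegral_neg_part hf, ereal_coe_ennreal h1,
    ereal_coe_ennreal h2, ← EReal.coe_sub]

lemma eint_mono {Q : Measure (Eu d)} {f g : Eu d → EReal} (h : ∀ x, f x ≤ g x) :
    eint Q f ≤ eint Q g := by
  unfold eint
  refine EReal.sub_le_sub ?_ ?_
  · exact EReal.coe_ennreal_le_coe_ennreal_iff.2 (lintegral_mono fun x => toENN_mono (h x))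
  · exact EReal.coe_ennreal_le_coe_ennreal_iff.2 (lintegral_mono fun x =>
      toENN_mono (EReal.neg_le_neg_iff.2 (h x)))

lemma Lfun_bound {Q : Measure (Eu d)} {φ : Eu d → EReal} {f : Eu d → ℝ} {c : ℝ}
    (hc : (c : EReal) ≤ Lfun φ Q) (hf : Integrable f Q) (h : ∀ x, φ x ≤ f x) :
    (∫⁻ x, EReal.exp (φ x)) ≠ ⊤ ∧
      c ≤ ∫ x, f x ∂Q - (∫⁻ x, EReal.exp (φ x)).toReal + 1 := by
  have h1 := eint_mono (Q := Q) h
  rw [eint_coe hf] at h1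
  unfold Lfun at hc
  have h2 : (∫⁻ x, EReal.exp (φ x)) ≠ ⊤ := by
    intro h3
    rw [h3] at hc
    simp at hc
  refine ⟨h2, ?_⟩
  rw [ereal_coe_ennreal h2] at hc
  have h3 : (c : EReal) ≤ ((∫ x, f x ∂Q - (∫⁻ x, EReal.exp (φ x)).toReal + 1 : ℝ) : EReal) := by
    refine hc.trans ?_
    rw [EReal.coe_add, EReal.coe_sub]
    gcongr
    · exact EReal.sub_le_sub h1 le_rfl
    · simp
  exact_mod_cast h3

lemma Lfun_coe {Q : Measure (Eu d)} {f : Eu d → ℝ} (hf : Integrable f Q)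
    (he : (∫⁻ x, EReal.exp (f x : EReal)) ≠ ⊤) :
    Lfun (fun x : Eu d => (f x : EReal)) Q =
      ((∫ x, f x ∂Q - (∫⁻ x : Eu d, EReal.exp (f x : EReal)).toReal + 1 : ℝ) : EReal) := by
  unfold Lfun
  rw [eint_coe hf, ereal_coe_ennreal he, EReal.coe_add, EReal.coe_sub]
  simp

lemma le_Lprof {Q : Measure (Eu d)} {φ : Eu d → EReal} (h : IsPhi φ) : Lfun φ Q ≤ Lprof Q := by
  unfold Lprof
  exact le_iSup₂ (f := fun (φ : Eu d → EReal) (_ : φ ∈ {φ : Eu d → EReal | IsPhi φ}) => Lfun φ Q) φ h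

lemma exists_of_lt_Lprof {Q : Measure (Eu d)} {c : EReal} (h : c < Lprof Q) :
    ∃ φ : Eu d → EReal, IsPhi φ ∧ c < Lfun φ Q := by
  unfold Lprof at h
  obtain ⟨φ, hφ⟩ := lt_iSup_iff.1 h
  obtain ⟨h1, h2⟩ := lt_iSup_iff.1 hφ
  exact ⟨φ, h1, h2⟩

/-- concavity in level form -/
lemma IsPhi.level {φ : Eu d → EReal} (h : IsPhi φ) {x y : Eu d} {s t a b : ℝ}
    (hx : (s : EReal) ≤ φ x) (hy : (t : EReal) ≤ φ y) (ha : 0 ≤ a) (hb : 0 ≤ b) (hab : a + b = 1) :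
    ((a * s + b * t : ℝ) : EReal) ≤ φ (a • x + b • y) := by
  rcases ha.eq_or_lt with rfl | ha
  · have : b = 1 := by linarith
    subst this; simpa using hy
  rcases hb.eq_or_lt with rfl | hb
  · have : a = 1 := by linarith
    subst this; simpa using hx
  refine le_trans ?_ (h.2.2.1 x y a b ha hb hab)
  rw [EReal.coe_add, EReal.coe_mul, EReal.coe_mul]
  have h1 : (0 : EReal) ≤ a := by exact_mod_cast ha.le
  have h2 : (0 : EReal) ≤ b := by exact_mod_cast hb.le
  gcongr

lemma IsPhi.convex_level {φ : Eu d → EReal} (h : IsPhi φ) (t : ℝ) :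
    Convex ℝ {x | (t : EReal) ≤ φ x} := by
  intro x hx y hy a b ha hb hab
  have := h.level hx hy ha hb hab
  rwa [← add_mul, hab, one_mul] at this

lemma IsPhi.closed_level {φ : Eu d → EReal} (h : IsPhi φ) (t : ℝ) :
    IsClosed {x | (t : EReal) ≤ φ x} := h.1.isClosed_preimage t

/-- `φ` attains its max -/
lemma IsPhi.exists_max {φ : Eu d → EReal} (h : IsPhi φ) : ∃ m, ∀ x, φ x ≤ φ m := by
  by_cases hb : ∀ x, φ x = ⊥
  · exact ⟨0, fun x => by rw [hb x]; exact bot_le⟩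
  push Not at hb
  obtain ⟨x0, hx0⟩ := hb
  have h1 : ∀ᶠ x in Filter.comap (fun x : Eu d => ‖x‖) atTop, φ x < φ x0 :=
    h.2.2.2.eventually_lt_const (bot_lt_iff_ne_bot.2 hx0)
  rw [eventually_comap] at h1
  obtain ⟨R, hR⟩ := eventually_atTop.1 h1
  obtain ⟨m, hm, hmax⟩ := UpperSemicontinuousOn.exists_isMaxOn (s := Metric.closedBall 0 (max R ‖x0‖))
    (f := φ) ⟨x0, by simp⟩ (isCompact_closedBall _ _) (h.1.upperSemicontinuousOn _)
  refine ⟨m, fun x => ?_⟩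
  by_cases hx : x ∈ Metric.closedBall 0 (max R ‖x0‖)
  · exact hmax hx
  · have h2 : max R ‖x0‖ < ‖x‖ := by simpa using hx
    exact (hR ‖x‖ ((le_max_left _ _).trans h2.le) x rfl).le.trans (hmax (by simp))

/-- test function for half-spaces -/
noncomputable def hsf (u x0 y : Eu d) : ℝ := min 1 (max (inner ℝ u (y - x0)) 0)

lemma hsf_nonneg (u x0 y : Eu d) : 0 ≤ hsf u x0 y := le_min zero_le_one (le_max_right _ _)
lemma hsf_le_one (u x0 y : Eu d) : hsf u x0 y ≤ 1 := min_le_left _ _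
lemma hsf_cont (u x0 : Eu d) : Continuous (hsf u x0) := by
  unfold hsf; fun_prop
lemma hsf_cont' (x0 y : Eu d) : Continuous (fun u => hsf u x0 y) := by
  unfold hsf; fun_prop
lemma hsf_int (P : Measure (Eu d)) [IsProbabilityMeasure P] (u x0 : Eu d) :
    Integrable (hsf u x0) P :=
  (integrable_const (1:ℝ)).mono' (hsf_cont u x0).aestronglyMeasurable
    (Eventually.of_forall fun y => by
      rw [Real.norm_eq_abs, abs_of_nonneg (hsf_nonneg _ _ _)]; exact hsf_le_one _ _ _)

lemma hsf_lip {u : Eu d} (hu : ‖u‖ = 1) (x0 : Eu d) : LipschitzWith 1 (hsf u x0) := by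
  have h1 : LipschitzWith 1 (fun y : Eu d => inner ℝ u (y - x0)) := by
    refine LipschitzWith.of_dist_le_mul fun y z => ?_
    rw [Real.dist_eq, ← inner_sub_right, dist_eq_norm]
    have := abs_real_inner_le_norm u (y - x0 - (z - x0))
    rw [hu] at this
    simpa using this
  exact (h1.max_const 0).const_min 1

lemma nondeg {Q : Measure (Eu d)} [IsProbabilityMeasure Q] (hQ : (interior (csupp Q)).Nonempty) :
    ∃ x0 : Eu d, ∃ η : ℝ, 0 < η ∧ ∀ u : Eu d, ‖u‖ = 1 → η ≤ ∫ y, hsf u x0 y ∂Q := by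
  obtain ⟨x0, hx0⟩ := hQ
  refine ⟨x0, ?_⟩
  have hpos : ∀ u : Eu d, ‖u‖ = 1 → 0 < ∫ y, hsf u x0 y ∂Q := by
    intro u hu
    refine lt_of_le_of_ne (integral_nonneg fun y => hsf_nonneg _ _ _) fun h0 => ?_
    have h1 := (integral_eq_zero_iff_of_nonneg (fun y => hsf_nonneg u x0 y) (hsf_int Q u x0)).1 h0.symm
    let C : Set (Eu d) := {y | inner ℝ u (y - x0) ≤ (0:ℝ)}
    have hC : IsClosed C := isClosed_le (by fun_prop) continuous_const
    have hCc : Convex ℝ C := by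
      intro y hy z hz a b ha hb hab
      have hy' : inner ℝ u (y - x0) ≤ (0:ℝ) := hy
      have hz' : inner ℝ u (z - x0) ≤ (0:ℝ) := hz
      show inner ℝ u (a • y + b • z - x0) ≤ (0:ℝ)
      have : a • y + b • z - x0 = a • (y - x0) + b • (z - x0) := by
        have : x0 = (a + b) • x0 := by rw [hab, one_smul]
        nth_rewrite 1 [this]
        module
      rw [this, inner_add_right, inner_smul_right, inner_smul_right]
      nlinarith
    have hQC : Q C = 1 := by
      have : ∀ᵐ y ∂Q, y ∈ C := by
        filter_upwards [h1] with y hy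
        by_contra hyC
        have h2 : (0:ℝ) < inner ℝ u (y - x0) := not_le.1 hyC
        have h3 : hsf u x0 y = 0 := hy
        have : 0 < hsf u x0 y := lt_min zero_lt_one (lt_max_of_lt_left h2)
        linarith
      exact (prob_compl_eq_zero_iff hC.measurableSet).1 this
    have hsub : csupp Q ⊆ C := sInter_subset_of_mem ⟨hC, hCc, hQC⟩
    obtain ⟨ρ, hρ, hball⟩ := Metric.mem_nhds_iff.1 (mem_interior_iff_mem_nhds.1 hx0)
    have h2 : x0 + (ρ / 2) • u ∈ C := hsub (hball (by
      rw [Metric.mem_ball, dist_eq_norm, add_sub_cancel_left, norm_smul, hu, Real.norm_eq_abs,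
        abs_of_pos (by positivity)]
      linarith))
    have h3 : inner ℝ u (x0 + (ρ / 2) • u - x0) ≤ (0:ℝ) := h2
    rw [add_sub_cancel_left, inner_smul_right, real_inner_self_eq_norm_sq, hu] at h3
    linarith
  have hcont : Continuous (fun u : Eu d => ∫ y, hsf u x0 y ∂Q) := by
    refine continuous_of_dominated (bound := fun _ => (1:ℝ))
      (fun u => (hsf_cont u x0).aestronglyMeasurable) (fun u => Eventually.of_forall fun y => ?_)
      (integrable_const _) (Eventually.of_forall fun y => hsf_cont' x0 y)
    rw [Real.norm_eq_abs, abs_of_nonneg (hsf_nonneg _ _ _)]; exact hsf_le_one _ _ _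
  rcases (Metric.sphere (0 : Eu d) 1).eq_empty_or_nonempty with he | hne
  · refine ⟨1, one_pos, fun u hu => ?_⟩
    have : u ∈ Metric.sphere (0 : Eu d) 1 := by simpa using hu
    rw [he] at this
    exact this.elim
  · obtain ⟨v, hv, hmin⟩ := (isCompact_sphere (0 : Eu d) 1).exists_isMinOn hne hcont.continuousOn
    exact ⟨_, hpos v (by simpa using hv), fun u hu => hmin (by simpa using hu)⟩

/-- uniform nondegeneracy property -/
def ND (P : Measure (Eu d)) (x0 : Eu d) (η : ℝ) : Prop :=
  ∀ C : Set (Eu d), IsClosed C → Convex ℝ C → ¬ (Metric.closedBall x0 η ⊆ C) → P.real C ≤ 1 - η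

lemma ND_of_hsf {P : Measure (Eu d)} [IsProbabilityMeasure P] {x0 : Eu d} {η : ℝ} (hη : 0 < η)
    (hη1 : η ≤ 1) (h : ∀ u : Eu d, ‖u‖ = 1 → 2 * η ≤ ∫ y, hsf u x0 y ∂P) : ND P x0 η := by
  intro C hC hCc hn
  rcases C.eq_empty_or_nonempty with rfl | ⟨w, hw⟩
  · simpa using hη1
  obtain ⟨y, hy, hyC⟩ := not_subset.1 hn
  obtain ⟨f, s, h1, h2⟩ := geometric_hahn_banach_closed_point hCc hC hyC
  obtain ⟨v, rfl⟩ := (InnerProductSpace.toDual ℝ (Eu d)).surjective f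
  simp only [InnerProductSpace.toDual_apply_apply] at h1 h2
  have hv : v ≠ 0 := by
    rintro rfl
    have := h1 w hw
    simp at this h2
    linarith
  have hvn : 0 < ‖v‖ := norm_pos_iff.2 hv
  have hu : ‖(‖v‖⁻¹ • v)‖ = 1 := by
    rw [norm_smul, norm_inv, norm_norm, inv_mul_cancel₀ hvn.ne']
  have h3 := h _ hu
  set u := ‖v‖⁻¹ • v with hudef
  have h4 : ∀ a ∈ C, inner ℝ u (a - x0) ≤ η := by
    intro a ha
    have e1 : inner ℝ u (a - x0) = inner ℝ u (a - y) + inner ℝ u (y - x0) := by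
      rw [← inner_add_right]; congr 1; abel
    have e2 : inner ℝ u (a - y) ≤ 0 := by
      rw [hudef, real_inner_smul_left, inner_sub_right]
      have := h1 a ha
      exact mul_nonpos_of_nonneg_of_nonpos (by positivity) (by linarith)
    have e3 : inner ℝ u (y - x0) ≤ η := by
      refine (real_inner_le_norm _ _).trans ?_
      rw [hu, one_mul, ← dist_eq_norm]
      exact hy
    linarith
  have h5 : ∫ y, hsf u x0 y ∂P ≤ ∫ y, (η + Cᶜ.indicator (fun _ => (1:ℝ)) y) ∂P := by
    refine integral_mono (hsf_int P u x0) ((integrable_const _).add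
      ((integrable_const _).indicator hC.measurableSet.compl)) fun z => ?_
    by_cases hz : z ∈ C
    · simp only [hz, mem_compl_iff, not_true_eq_false, not_false_eq_true, indicator_of_notMem, add_zero]
      exact (min_le_right _ _).trans (max_le (h4 z hz) hη.le)
    · have : z ∈ Cᶜ := hz
      simp only [this, indicator_of_mem]
      linarith [hsf_le_one u x0 z]
  rw [integral_add (integrable_const _) ((integrable_const _).indicator hC.measurableSet.compl),
    integral_indicator hC.measurableSet.compl] at h5
  simp [probReal_compl_eq_one_sub hC.measurableSet] at h5
  linarith

lemma exists_ND {Qn : ℕ → Measure (Eu d)} {Q : Measure (Eu d)}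
    [∀ n, IsProbabilityMeasure (Qn n)] [IsProbabilityMeasure Q]
    (hQ : (interior (csupp Q)).Nonempty) (hw : WConv Qn Q) :
    ∃ x0 : Eu d, ∃ η : ℝ, 0 < η ∧ η ≤ 1 ∧ ∀ᶠ n in atTop, ND (Qn n) x0 η := by
  obtain ⟨x0, η, hη, h⟩ := nondeg hQ
  refine ⟨x0, min 1 (η / 3), by positivity, min_le_left _ _, ?_⟩
  filter_upwards [hw.uniform_BL 1 1 (δ := η / 3) (by positivity)] with n hn
  refine ND_of_hsf (by positivity) (min_le_left _ _) fun u hu => ?_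
  have h1 := hn (fun y => - hsf u x0 y) (hsf_lip hu x0).neg
    (fun y => by rw [abs_neg, abs_of_nonneg (hsf_nonneg _ _ _)]; exact hsf_le_one _ _ _)
  rw [integral_neg, integral_neg] at h1
  have := h u hu
  have := min_le_right 1 (η / 3)
  linarith

/-! ### a priori bounds -/

lemma level_vol {φ : Eu d → EReal} (h : IsPhi φ) (t : ℝ) :
    ENNReal.ofReal (Real.exp t) * volume {x | (t : EReal) ≤ φ x} ≤ ∫⁻ x, EReal.exp (φ x) := by
  rw [← setLIntegral_const]
  refine le_trans ?_ (setLIntegral_le_lintegral {x | (t : EReal) ≤ φ x} _)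
  refine setLIntegral_mono' (h.closed_level t).measurableSet fun x hx => ?_
  rw [← EReal.exp_coe]
  exact EReal.exp_monotone hx

lemma level_vol_real {φ : Eu d → EReal} (h : IsPhi φ) (t : ℝ) (hI : ∫⁻ x, EReal.exp (φ x) ≠ ⊤)
    {S : Set (Eu d)} (hS : S ⊆ {x | (t : EReal) ≤ φ x}) :
    Real.exp t * (volume S).toReal ≤ (∫⁻ x, EReal.exp (φ x)).toReal := by
  have h1 : ENNReal.ofReal (Real.exp t) * volume S ≤ ∫⁻ x, EReal.exp (φ x) :=
    le_trans (by gcongr) (level_vol h t)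
  have := ENNReal.toReal_mono hI h1
  rwa [ENNReal.toReal_mul, ENNReal.toReal_ofReal (Real.exp_pos _).le] at this

lemma Lfun_level {P : Measure (Eu d)} [IsProbabilityMeasure P] {φ : Eu d → EReal} (h : IsPhi φ)
    {x0 : Eu d} {η M t c : ℝ} (hND : ND P x0 η) (hM : ∀ x, φ x ≤ (M : EReal))
    (htM : t ≤ M) (hc : (c : EReal) ≤ Lfun φ P)
    (hn : ¬ (Metric.closedBall x0 η ⊆ {x | (t : EReal) ≤ φ x})) :
    c ≤ M - η * (M - t) + 1 := by
  set D := {x | (t : EReal) ≤ φ x} with hD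
  have hDm : MeasurableSet D := (h.closed_level t).measurableSet
  have h1 := hND D (h.closed_level t) (h.convex_level t) hn
  have hi : Integrable (fun x => t + D.indicator (fun _ => M - t) x) P :=
    (integrable_const _).add ((integrable_const _).indicator hDm)
  have h2 := (Lfun_bound hc hi (fun x => by
    by_cases hx : x ∈ D
    · simp only [hx, indicator_of_mem]
      simpa using hM x
    · simp only [hx, not_false_eq_true, indicator_of_notMem, add_zero]
      exact (not_le.1 hx).le)).2
  rw [integral_add (integrable_const _) ((integrable_const _).indicator hDm),
    integral_indicator hDm] at h2
  simp at h2
  have h3 : 0 ≤ (∫⁻ x, EReal.exp (φ x)).toReal := ENNReal.toReal_nonneg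
  have h4 : P.real D * (M - t) ≤ (1 - η) * (M - t) := by
    gcongr
  linarith

lemma ball_vol_pos (z : Eu d) {r : ℝ} (hr : 0 < r) : 0 < (volume (Metric.ball z r)).toReal :=
  ENNReal.toReal_pos (Metric.measure_ball_pos _ _ hr).ne' measure_ball_lt_top.ne

lemma bound_M (x0 : Eu d) {η : ℝ} (hη : 0 < η) (hη1 : η ≤ 1) (c : ℝ) :
    ∃ M : ℝ, 0 ≤ M ∧ ∀ (P : Measure (Eu d)) [IsProbabilityMeasure P], ND P x0 η →
      ∀ φ : Eu d → EReal, IsPhi φ → (c : EReal) ≤ Lfun φ P → ∀ x, φ x ≤ (M : EReal) := by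
  set s := η / 4 with hs
  have hs0 : 0 < s := by positivity
  have hs1 : s < 1 := by rw [hs]; linarith
  set v := (volume (Metric.ball (0 : Eu d) (s * η))).toReal with hv
  have hv0 : 0 < v := ball_vol_pos _ (by positivity)
  refine ⟨max 0 (max (1 - c) (16 / v)), le_max_left _ _, fun P _ hND φ h hc x => ?_⟩
  obtain ⟨m, hm⟩ := h.exists_max
  refine (hm x).trans ?_
  by_contra hcon
  have hcon := not_le.1 hcon
  have hmtop := h.2.1 m
  have hmbot : φ m ≠ ⊥ := ne_bot_of_gt hcon
  obtain ⟨M, hMm⟩ : ∃ M : ℝ, φ m = M := ⟨_, (EReal.coe_toReal hmtop hmbot).symm⟩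
  rw [hMm] at hcon hm
  have hcon : max 0 (max (1 - c) (16 / v)) < M := by exact_mod_cast hcon
  obtain ⟨hM0, hcon⟩ := max_lt_iff.1 hcon
  obtain ⟨hMc, hMv⟩ := max_lt_iff.1 hcon
  set t := - (2 / η - 1) * M with ht
  have hη2 : η * (2 / η) = 2 := by field_simp
  have h2η : 1 ≤ 2 / η := by rw [le_div_iff₀ hη]; linarith
  by_cases hn : Metric.closedBall x0 η ⊆ {x | (t : EReal) ≤ φ x}
  · have hsub : Metric.ball ((1 - s) • m + s • x0) (s * η) ⊆ {x | ((M / 2 : ℝ) : EReal) ≤ φ x} := by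
      intro z hz
      have hw : x0 + s⁻¹ • (z - ((1 - s) • m + s • x0)) ∈ Metric.closedBall x0 η := by
        rw [Metric.mem_closedBall, dist_eq_norm, add_sub_cancel_left, norm_smul, norm_inv,
          Real.norm_eq_abs, abs_of_pos hs0, inv_mul_le_iff₀ hs0, ← dist_eq_norm]
        exact (Metric.mem_ball.1 hz).le
      have h1 := h.level (x := m) (s := M) (by rw [hMm]) (hn hw) (a := 1 - s) (b := s)
        (by linarith) hs0.le (by ring)
      have e1 : (1 - s) * M + s * t = M / 2 := by
        rw [ht, hs]
        have : η / 4 * (-(2 / η - 1) * M) = - (η * (2 / η)) / 4 * M + η / 4 * M := by ring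
        rw [this, hη2]; ring
      have e2 : (1 - s) • m + s • (x0 + s⁻¹ • (z - ((1 - s) • m + s • x0))) = z := by
        rw [smul_add, smul_inv_smul₀ hs0.ne']; abel
      rw [e1, e2] at h1
      exact h1
    obtain ⟨hI, h2⟩ := Lfun_bound hc (integrable_const M) hm
    have h3 := level_vol_real h _ hI hsub
    rw [Measure.addHaar_ball_center, ← hv] at h3
    simp at h2
    have h4 : (M / 2) ^ 2 / 2 ≤ Real.exp (M / 2) := by
      have := Real.quadratic_le_exp_of_nonneg (x := M / 2) (by positivity)
      linarith
    have h5 : 16 < M * v := by rwa [div_lt_iff₀ hv0] at hMv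
    have h6 : (M / 2) ^ 2 / 2 * v ≤ Real.exp (M / 2) * v := by gcongr
    nlinarith
  · have h1 := Lfun_level h hND hm (by rw [ht]; nlinarith) hc hn
    have : η * (M - t) = 2 * M := by
      rw [ht]; linear_combination M * hη2
    linarith

lemma bound_K (x0 : Eu d) {η : ℝ} (hη : 0 < η) (c M : ℝ) (hM0 : 0 ≤ M) :
    ∃ t : ℝ, ∀ (P : Measure (Eu d)) [IsProbabilityMeasure P], ND P x0 η →
      ∀ φ : Eu d → EReal, IsPhi φ → (c : EReal) ≤ Lfun φ P → (∀ x, φ x ≤ (M : EReal)) →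
      Metric.closedBall x0 η ⊆ {x | (t : EReal) ≤ φ x} := by
  refine ⟨min 0 ((c - 2 - M) / η), fun P _ hND φ h hc hM => ?_⟩
  by_contra hn
  have h1 := Lfun_level h hND hM ((min_le_left _ _).trans hM0) hc hn
  have h2 : η * min 0 ((c - 2 - M) / η) ≤ c - 2 - M := by
    calc _ ≤ η * ((c - 2 - M) / η) := by gcongr; exact min_le_right _ _
      _ = _ := by field_simp
  nlinarith

lemma convex_vol {D : Set (Eu d)} (hD : Convex ℝ D) {x0 x : Eu d} {η : ℝ} (hη : 0 < η)
    (hb : Metric.closedBall x0 η ⊆ D) (hx : x ∈ D) (m : ℕ) (hm : m * η ≤ ‖x - x0‖ / 2) :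
    (m : ℝ≥0∞) * volume (Metric.ball (0 : Eu d) (η / 2)) ≤ volume D := by
  rcases Nat.eq_zero_or_pos m with rfl | hmpos
  · simp
  have hL : 0 < ‖x - x0‖ := by
    have : 0 < (m : ℝ) * η := by positivity
    linarith
  set L := ‖x - x0‖ with hLdef
  let cen : ℕ → Eu d := fun k => x0 + (k * η / L) • (x - x0)
  have h1 : ⋃ k ∈ Finset.range m, Metric.ball (cen k) (η / 2) ⊆ D := by
    intro z hz
    simp only [mem_iUnion, Finset.mem_range] at hz
    obtain ⟨k, hk, hz⟩ := hz
    set σ := k * η / L with hσ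
    have hσ0 : 0 ≤ σ := by positivity
    have hσ1 : σ ≤ 1 / 2 := by
      rw [hσ, div_le_iff₀ hL]
      have : (k : ℝ) * η ≤ m * η := by gcongr
      linarith
    have hσ2 : 0 < 1 - σ := by linarith
    have hw : x0 + (1 - σ)⁻¹ • (z - cen k) ∈ D := by
      apply hb
      rw [Metric.mem_closedBall, dist_eq_norm, add_sub_cancel_left, norm_smul, norm_inv,
          Real.norm_eq_abs, abs_of_pos hσ2, inv_mul_le_iff₀ hσ2, ← dist_eq_norm]
      have := Metric.mem_ball.1 hz
      nlinarith
    have h2 := hD hx hw hσ0 hσ2.le (by ring)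
    have e : σ • x + (1 - σ) • (x0 + (1 - σ)⁻¹ • (z - cen k)) = z := by
      rw [smul_add, smul_inv_smul₀ hσ2.ne']
      simp only [cen, ← hσ]
      module
    rwa [e] at h2
  refine le_trans (le_of_eq ?_) (measure_mono h1)
  rw [measure_biUnion_finset]
  · simp [Measure.addHaar_ball_center]
  · intro k _ l _ hkl
    refine Metric.ball_disjoint_ball ?_
    have : dist (cen k) (cen l) = |(k:ℝ) - l| * η := by
      simp only [cen]
      rw [dist_add_left, dist_eq_norm, ← sub_smul, norm_smul, ← hLdef, Real.norm_eq_abs, ← sub_div,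
        ← sub_mul, abs_div, abs_mul, abs_of_pos hη, abs_of_pos hL]
      field_simp
    rw [this]
    have h3 : (1:ℝ) ≤ |(k:ℝ) - l| := by
      have : (1:ℤ) ≤ |(k:ℤ) - l| := Int.one_le_abs (by omega)
      exact_mod_cast this
    nlinarith
  · exact fun _ _ => Metric.isOpen_ball.measurableSet

/-- The a priori bounds. -/
lemma core_fixed (x0 : Eu d) {η : ℝ} (hη : 0 < η) (hη1 : η ≤ 1) (c : ℝ) :
    ∃ a b K : ℝ, 0 < b ∧ ∀ (P : Measure (Eu d)) [IsProbabilityMeasure P], ND P x0 η →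
      ∀ φ : Eu d → EReal, IsPhi φ → (c : EReal) ≤ Lfun φ P →
      (∀ x, φ x ≤ ((a - b * ‖x‖ : ℝ) : EReal)) ∧
      (∀ x ∈ Metric.closedBall x0 η, (K : EReal) ≤ φ x) := by
  obtain ⟨M, hM0, hM⟩ := bound_M x0 hη hη1 c
  obtain ⟨t, ht⟩ := bound_K x0 hη c M hM0
  set v := (volume (Metric.ball (0 : Eu d) (η / 2))).toReal with hv
  have hv0 : 0 < v := ball_vol_pos _ (by positivity)
  set B := |M + 1 - c| / (Real.exp (t - 1) * v) with hB
  have hB0 : 0 ≤ B := by positivity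
  set R := 2 * η * (B + 1) with hR
  have hR0 : 0 < R := by positivity
  refine ⟨M + 1 + ‖x0‖ / R, 1 / R, t, by positivity, fun P _ hND φ h hc => ?_⟩
  have hφM := hM P hND φ h hc
  have hball := ht P hND φ h hc hφM
  refine ⟨?_, fun x hx => hball hx⟩
  obtain ⟨hI, h2⟩ := Lfun_bound hc (integrable_const M) hφM
  simp at h2
  -- the level set is bounded
  have hbdd : ∀ x, ((t - 1 : ℝ) : EReal) ≤ φ x → ‖x - x0‖ < R := by
    intro x hx
    set m := ⌊‖x - x0‖ / (2 * η)⌋₊ with hm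
    have hm1 : (m : ℝ) ≤ ‖x - x0‖ / (2 * η) := Nat.floor_le (by positivity)
    have hm2 : ‖x - x0‖ / (2 * η) < m + 1 := Nat.lt_floor_add_one _
    have h3 := convex_vol (h.convex_level (t - 1)) hη
      (hball.trans fun y hy => le_trans (EReal.coe_le_coe_iff.2 (by linarith : t - 1 ≤ t)) hy) hx m (by
        rw [le_div_iff₀ (by positivity)] at hm1; linarith)
    have h4 : ENNReal.ofReal (Real.exp (t - 1)) * (m * volume (Metric.ball (0 : Eu d) (η / 2)))
      ≤ ∫⁻ x, EReal.exp (φ x) := le_trans (by gcongr) (level_vol h (t - 1))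
    have h5 := ENNReal.toReal_mono hI h4
    rw [ENNReal.toReal_mul, ENNReal.toReal_mul, ENNReal.toReal_ofReal (Real.exp_pos _).le, ← hv] at h5
    simp only [ENNReal.toReal_natCast] at h5
    have h6 : (m : ℝ) ≤ B := by
      rw [hB, le_div_iff₀ (by positivity)]
      calc (m : ℝ) * (Real.exp (t - 1) * v) = Real.exp (t - 1) * (m * v) := by ring
        _ ≤ M + 1 - c := by linarith
        _ ≤ _ := le_abs_self _
    rw [div_lt_iff₀ (by positivity)] at hm2
    rw [hR]
    nlinarith
  intro x
  by_cases hxb : φ x = ⊥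
  · rw [hxb]; exact bot_le
  obtain ⟨p, hp⟩ : ∃ p : ℝ, φ x = p := ⟨_, (EReal.coe_toReal (h.2.1 x) hxb).symm⟩
  have hx0t : (t : EReal) ≤ φ x0 := hball (by simp [hη.le])
  obtain ⟨q, hq⟩ : ∃ q : ℝ, φ x0 = q := ⟨_, (EReal.coe_toReal (h.2.1 x0) (by
    intro hbot; rw [hbot] at hx0t; exact (EReal.bot_lt_coe t).not_ge hx0t)).symm⟩
  have htq : t ≤ q := by rw [hq] at hx0t; exact_mod_cast hx0t
  have hqM : q ≤ M := by have := hφM x0; rw [hq] at this; exact_mod_cast this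
  have hpM : p ≤ M := by have := hφM x; rw [hp] at this; exact_mod_cast this
  have hn : ‖x‖ ≤ ‖x - x0‖ + ‖x0‖ := by
    have := norm_add_le (x - x0) x0
    simpa using this
  have hn' : ‖x‖ / R ≤ ‖x - x0‖ / R + ‖x0‖ / R := by rw [← add_div]; gcongr
  rw [hp]
  suffices hgoal : p ≤ M + 1 - ‖x - x0‖ / R by
    have : p ≤ M + 1 + ‖x0‖ / R - 1 / R * ‖x‖ := by
      rw [one_div_mul_eq_div]; linarith
    exact_mod_cast this
  rcases lt_or_ge ‖x - x0‖ R with hlt | hge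
  · have : ‖x - x0‖ / R ≤ 1 := by rw [div_le_one hR0]; exact hlt.le
    linarith
  · set L := ‖x - x0‖ with hL
    have hL0 : 0 < L := lt_of_lt_of_le hR0 hge
    set σ := R / L with hσ
    have hσ0 : 0 < σ := by positivity
    have hσ1 : σ ≤ 1 := by rw [hσ, div_le_one hL0]; exact hge
    have h7 := h.level (x := x) (y := x0) (s := p) (t := q) hp.ge hq.ge hσ0.le
      (by linarith : 0 ≤ 1 - σ) (by ring)
    have h8 : ‖σ • x + (1 - σ) • x0 - x0‖ = R := by
      have : σ • x + (1 - σ) • x0 - x0 = σ • (x - x0) := by module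
      rw [this, norm_smul, Real.norm_eq_abs, abs_of_pos hσ0, ← hL, hσ]
      field_simp
    have h9 : ¬ ((t - 1 : ℝ) : EReal) ≤ φ (σ • x + (1 - σ) • x0) := fun hh =>
      absurd (hbdd _ hh) (by rw [h8]; exact lt_irrefl _)
    have h10 : σ * p + (1 - σ) * q < t - 1 := by
      exact_mod_cast h7.trans_lt (not_le.1 h9)
    have h11 : σ * (L / R) = 1 := by rw [hσ]; field_simp
    have h12 : σ * p < σ * (q - L / R) := by linarith
    have h13 := lt_of_mul_lt_mul_left h12 hσ0.le
    linarith

/-- Lipschitz regularization -/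
noncomputable def regf (φ : Eu d → EReal) (Λ : ℝ) (x : Eu d) : ℝ :=
  ⨆ y : {y // φ y ≠ ⊥}, ((φ y.1).toReal - Λ * ‖x - y.1‖)

lemma phi_real {φ : Eu d → EReal} (h : IsPhi φ) {y : Eu d} (hy : φ y ≠ ⊥) :
    φ y = ((φ y).toReal : EReal) := (EReal.coe_toReal (h.2.1 y) hy).symm

lemma regf_bdd {φ : Eu d → EReal} (h : IsPhi φ) {a Λ : ℝ} (hΛ : 0 ≤ Λ) (ha : ∀ x, φ x ≤ (a : EReal))
    (x : Eu d) : BddAbove (range fun y : {y // φ y ≠ ⊥} => ((φ y.1).toReal - Λ * ‖x - y.1‖)) := by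
  refine ⟨a, ?_⟩
  rintro _ ⟨⟨y, hy⟩, rfl⟩
  have h1 := ha y
  rw [phi_real h hy] at h1
  have h2 : (φ y).toReal ≤ a := by exact_mod_cast h1
  have : 0 ≤ Λ * ‖x - y‖ := by positivity
  simp only
  linarith

lemma regf_ge {φ : Eu d → EReal} (h : IsPhi φ) {a Λ : ℝ} (hΛ : 0 ≤ Λ) (ha : ∀ x, φ x ≤ (a : EReal))
    {x y : Eu d} {p : ℝ} (hp : (p : EReal) ≤ φ y) : p - Λ * ‖x - y‖ ≤ regf φ Λ x := by
  have hy : φ y ≠ ⊥ := by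
    intro hb; rw [hb] at hp; exact (EReal.bot_lt_coe p).not_ge hp
  have h1 := le_ciSup (regf_bdd h hΛ ha x) ⟨y, hy⟩
  rw [phi_real h hy] at hp
  have h2 : p ≤ (φ y).toReal := by exact_mod_cast hp
  simp only at h1
  unfold regf
  linarith

lemma regf_approx {φ : Eu d → EReal} (h : IsPhi φ) {Λ : ℝ}
    (hne : ∃ y, φ y ≠ ⊥) (x : Eu d) {κ : ℝ} (hκ : 0 < κ) :
    ∃ y : Eu d, ∃ p : ℝ, φ y = p ∧ regf φ Λ x - κ < p - Λ * ‖x - y‖ := by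
  obtain ⟨y0, hy0⟩ := hne
  have : Nonempty {y // φ y ≠ ⊥} := ⟨⟨y0, hy0⟩⟩
  obtain ⟨⟨y, hy⟩, h1⟩ := exists_lt_of_lt_ciSup (show regf φ Λ x - κ < regf φ Λ x by linarith)
  exact ⟨y, _, phi_real h hy, h1⟩

lemma isPhi_of_real {g : Eu d → ℝ} (hg : Continuous g) {a b : ℝ} (hb : 0 < b)
    (hle : ∀ x, g x ≤ a - b * ‖x‖)
    (hconc : ∀ x y : Eu d, ∀ s t : ℝ, 0 < s → 0 < t → s + t = 1 →
      s * g x + t * g y ≤ g (s • x + t • y)) :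
    IsPhi (fun x => (g x : EReal)) := by
  refine ⟨?_, fun x => EReal.coe_ne_top _, ?_, ?_⟩
  · exact (continuous_coe_real_ereal.comp hg).upperSemicontinuous
  · intro x y s t hs ht hst
    have := hconc x y s t hs ht hst
    beta_reduce
    exact_mod_cast this
  · rw [EReal.tendsto_nhds_bot_iff_real]
    intro r
    rw [eventually_comap]
    filter_upwards [eventually_gt_atTop ((a - r) / b)] with R hR x hx
    rw [div_lt_iff₀ hb] at hR
    have := hle x
    rw [hx] at this
    exact_mod_cast (by linarith : g x < r)

lemma integrable_exp_norm (a : ℝ) {b : ℝ} (hb : 0 < b) :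
    Integrable (fun x : Eu d => Real.exp (a - b * ‖x‖)) := by
  have h1 : Integrable (fun x : Eu d => (1 + ‖x‖) ^ (-((d + 1 : ℕ) : ℝ))) :=
    integrable_one_add_norm (by simp)
  refine (h1.const_mul (Real.exp a * (((d+1).factorial : ℝ) * Real.exp b / b ^ (d + 1)))).mono'
    (by fun_prop) (Eventually.of_forall fun x => ?_)
  rw [Real.norm_eq_abs, abs_of_pos (Real.exp_pos _), Real.rpow_neg (by positivity),
    Real.rpow_natCast]
  have h2 := Real.pow_div_factorial_le_exp (b * (1 + ‖x‖)) (by positivity) (d + 1)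
  rw [mul_add, mul_one, Real.exp_add, ← mul_one_add, mul_pow] at h2
  rw [sub_eq_add_neg, Real.exp_add, mul_assoc]
  gcongr
  rw [Real.exp_neg, inv_le_iff_one_le_mul₀ (Real.exp_pos _)]
  rw [div_le_iff₀ (by positivity)] at h2
  have h3 : 0 < b ^ (d + 1) * (1 + ‖x‖) ^ (d + 1) := by positivity
  calc (1:ℝ) = (b ^ (d + 1) * (1 + ‖x‖) ^ (d + 1)) / (b ^ (d + 1) * (1 + ‖x‖) ^ (d + 1)) :=
        (div_self h3.ne').symm
    _ ≤ (Real.exp b * Real.exp (b * ‖x‖) * ((d + 1).factorial : ℝ)) / (b ^ (d + 1) * (1 + ‖x‖) ^ (d + 1)) := by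
        gcongr
    _ = _ := by field_simp

lemma lintegral_dilate (f : Eu d → ℝ≥0∞) (x0 : Eu d) {r : ℝ} (hr : r ≠ 0) :
    ∫⁻ x, f (x0 + r • (x - x0)) = ENNReal.ofReal |(r ^ d)⁻¹| * ∫⁻ x, f x := by
  have h1 := lintegral_sub_right_eq_self (μ := (volume : Measure (Eu d)))
    (fun x => f (x0 + r • x)) x0
  rw [h1]
  have h2 := lintegral_map_equiv (μ := (volume : Measure (Eu d))) (fun x => f (x0 + x))
    (Homeomorph.smulOfNeZero r hr).toMeasurableEquiv
  have h3 : Measure.map (⇑(Homeomorph.smulOfNeZero (α := Eu d) r hr).toMeasurableEquiv)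
      (volume : Measure (Eu d)) = ENNReal.ofReal |(r ^ d)⁻¹| • volume := by
    have := Measure.map_addHaar_smul (volume : Measure (Eu d)) hr
    rw [finrank_euclideanSpace_fin] at this
    exact this
  rw [h3, lintegral_smul_measure, lintegral_add_left_eq_self] at h2
  exact h2.symm

lemma tail_small (a : ℝ) {b δ : ℝ} (hb : 0 < b) (hδ : 0 < δ) :
    ∃ T : ℝ, ∫⁻ x : Eu d, ENNReal.ofReal (min (Real.exp (-T)) (Real.exp (a - b * ‖x‖)))
      ≤ ENNReal.ofReal δ := by
  have h1 : Tendsto (fun n : ℕ => ∫⁻ x : Eu d, ENNReal.ofReal (min (Real.exp (-(n:ℝ)))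
      (Real.exp (a - b * ‖x‖)))) atTop (𝓝 (∫⁻ _ : Eu d, 0)) := by
    refine tendsto_lintegral_of_dominated_convergence
      (fun x => ENNReal.ofReal (Real.exp (a - b * ‖x‖))) (fun n => by fun_prop)
      (fun n => Eventually.of_forall fun x => ENNReal.ofReal_le_ofReal (min_le_right _ _))
      (integrable_exp_norm a hb).lintegral_lt_top.ne (Eventually.of_forall fun x => ?_)
    have h2 : Tendsto (fun n : ℕ => Real.exp (-(n:ℝ))) atTop (𝓝 0) :=
      (Real.tendsto_exp_neg_atTop_nhds_zero).comp tendsto_natCast_atTop_atTop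
    have h3 := h2.min (tendsto_const_nhds (x := Real.exp (a - b * ‖x‖)))
    rw [min_eq_left (Real.exp_pos _).le] at h3
    have := ENNReal.tendsto_ofReal h3
    simpa using this
  rw [lintegral_zero] at h1
  obtain ⟨n, hn⟩ := (h1.eventually_le_const (by simpa using hδ : 0 < ENNReal.ofReal δ)).exists
  exact ⟨n, hn⟩

lemma factor_small (J A : ℝ) {δ : ℝ} (hδ : 0 < δ) (d : ℕ) :
    ∃ s : ℝ, 0 < s ∧ s < 1 ∧ (Real.exp (s * A) * |((1 - s) ^ d)⁻¹| - 1) * J ≤ δ := by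
  have h1 : ContinuousAt (fun s : ℝ => (Real.exp (s * A) * |((1 - s) ^ d)⁻¹| - 1) * J) 0 := by
    have : ((1:ℝ) - 0) ^ d ≠ 0 := by simp
    fun_prop (disch := assumption)
  have h2 : ∀ᶠ s in 𝓝[>] (0:ℝ), (Real.exp (s * A) * |((1 - s) ^ d)⁻¹| - 1) * J < δ := by
    have := h1.tendsto.eventually_lt_const (u := δ) (by simpa using hδ)
    exact this.filter_mono nhdsWithin_le_nhds
  have h3 : ∀ᶠ s in 𝓝[>] (0:ℝ), s ∈ Ioo (0:ℝ) 1 := Ioo_mem_nhdsGT one_pos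
  obtain ⟨s, hs, hs'⟩ := (h2.and h3).exists
  exact ⟨s, hs'.1, hs'.2, hs.le⟩

lemma reg_lemma (x0 : Eu d) {η : ℝ} (hη : 0 < η) (a : ℝ) {b : ℝ} (hb : 0 < b) (K : ℝ) {δ : ℝ}
    (hδ : 0 < δ) : ∃ Λ : ℝ≥0, ∀ φ : Eu d → EReal, IsPhi φ →
      (∀ x, φ x ≤ ((a - b * ‖x‖ : ℝ) : EReal)) →
      (∀ x ∈ Metric.closedBall x0 η, (K : EReal) ≤ φ x) →
      ∃ g : Eu d → ℝ, LipschitzWith Λ g ∧ (∀ x, φ x ≤ (g x : EReal)) ∧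
        (∀ x, g x ≤ a - b * ‖x‖) ∧ (∀ x, K - Λ * ‖x - x0‖ ≤ g x) ∧
        IsPhi (fun x => (g x : EReal)) ∧ (∫⁻ x, EReal.exp (g x : EReal)) ≠ ⊤ ∧
        (∫⁻ x, EReal.exp (g x : EReal)).toReal ≤ (∫⁻ x, EReal.exp (φ x)).toReal + δ := by
  set J := ∫⁻ x : Eu d, ENNReal.ofReal (Real.exp (a - b * ‖x‖)) with hJ
  have hJtop : J ≠ ⊤ := (integrable_exp_norm a hb).lintegral_lt_top.ne
  obtain ⟨T, hT⟩ := tail_small (d := d) a hb (half_pos hδ)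
  obtain ⟨s, hs0, hs1, hs⟩ := factor_small J.toReal (a - K + 1) (half_pos hδ) d
  set Λ : ℝ≥0 := Real.toNNReal (max b ((a + T + 1) / (s * η))) with hΛ
  have hΛ0 : (0:ℝ) ≤ Λ := Λ.2
  have hΛb : b ≤ Λ := (le_max_left _ _).trans (Real.le_coe_toNNReal _)
  have hΛs : (a + T + 1) / (s * η) ≤ Λ := (le_max_right _ _).trans (Real.le_coe_toNNReal _)
  have hΛpos : (0:ℝ) < Λ := lt_of_lt_of_le hb hΛb
  refine ⟨Λ, fun φ h hup hlow => ?_⟩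
  have ha : ∀ x, φ x ≤ (a : EReal) := fun x => (hup x).trans (by
    have : 0 ≤ b * ‖x‖ := by positivity
    exact_mod_cast (by linarith : a - b * ‖x‖ ≤ a))
  have hx0 : (K : EReal) ≤ φ x0 := hlow x0 (by simp [hη.le])
  have hne : ∃ y, φ y ≠ ⊥ := ⟨x0, by
    intro hbot; rw [hbot] at hx0; exact (EReal.bot_lt_coe K).not_ge hx0⟩
  set g := regf φ Λ with hg
  have R1 : ∀ {x y : Eu d} {p : ℝ}, (p : EReal) ≤ φ y → p - Λ * ‖x - y‖ ≤ g x :=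
    fun hp => regf_ge h hΛ0 ha hp
  have R2 : ∀ (x : Eu d) {κ : ℝ}, 0 < κ → ∃ y : Eu d, ∃ p : ℝ, φ y = p ∧ g x - κ < p - Λ * ‖x - y‖ :=
    fun x κ hκ => regf_approx h hne x hκ
  have hlip : LipschitzWith Λ g := by
    refine LipschitzWith.of_le_add_mul _ fun x x' => ?_
    refine le_of_forall_pos_le_add fun κ hκ => ?_
    obtain ⟨y, p, hp, h1⟩ := R2 x hκ
    have h2 := R1 (x := x') hp.ge
    have h3 : ‖x' - y‖ ≤ ‖x - y‖ + dist x x' := by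
      have := norm_add_le (x' - x) (x - y)
      rw [sub_add_sub_cancel, ← dist_eq_norm x' x, dist_comm] at this
      linarith
    have h4 : Λ * ‖x' - y‖ ≤ Λ * (‖x - y‖ + dist x x') := by gcongr
    linarith
  have hφg : ∀ x, φ x ≤ (g x : EReal) := by
    intro x
    by_cases hx : φ x = ⊥
    · rw [hx]; exact bot_le
    · have := R1 (x := x) (phi_real h hx).ge
      rw [phi_real h hx]
      simp at this
      exact_mod_cast this
  have hgup : ∀ x, g x ≤ a - b * ‖x‖ := by
    intro x
    refine le_of_forall_pos_le_add fun κ hκ => ?_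
    obtain ⟨y, p, hp, h1⟩ := R2 x hκ
    have h2 := hup y
    rw [hp] at h2
    have h2 : p ≤ a - b * ‖y‖ := by exact_mod_cast h2
    have h3 : ‖x‖ ≤ ‖x - y‖ + ‖y‖ := by
      have := norm_add_le (x - y) y
      simpa using this
    have h4 : b * ‖x - y‖ ≤ Λ * ‖x - y‖ := by gcongr
    nlinarith
  have hglow : ∀ x, K - Λ * ‖x - x0‖ ≤ g x := fun x => R1 hx0
  have hphi : IsPhi (fun x => (g x : EReal)) := by
    refine isPhi_of_real hlip.continuous hb hgup ?_
    intro x x' α β hα hβ hαβ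
    refine le_of_forall_pos_le_add fun κ hκ => ?_
    obtain ⟨y, p, hp, h1⟩ := R2 x hκ
    obtain ⟨y', p', hp', h1'⟩ := R2 x' hκ
    have h2 := R1 (x := α • x + β • x') (h.level hp.ge hp'.ge hα.le hβ.le hαβ)
    have h3 : ‖α • x + β • x' - (α • y + β • y')‖ ≤ α * ‖x - y‖ + β * ‖x' - y'‖ := by
      have : α • x + β • x' - (α • y + β • y') = α • (x - y) + β • (x' - y') := by module
      rw [this]
      refine (norm_add_le _ _).trans ?_
      rw [norm_smul, norm_smul, Real.norm_eq_abs, Real.norm_eq_abs, abs_of_pos hα, abs_of_pos hβ]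
    have h4 := mul_le_mul_of_nonneg_left h3 hΛ0
    have h5 := mul_le_mul_of_nonneg_left h1.le hα.le
    have h6 := mul_le_mul_of_nonneg_left h1'.le hβ.le
    have h7 : α * κ + β * κ = κ := by rw [← add_mul, hαβ, one_mul]
    nlinarith
  have hIg : (∫⁻ x, EReal.exp (g x : EReal)) ≠ ⊤ := by
    refine ne_top_of_le_ne_top hJtop (lintegral_mono fun x => ?_)
    rw [EReal.exp_coe]
    exact ENNReal.ofReal_le_ofReal (Real.exp_le_exp.2 (hgup x))
  have hIφJ : (∫⁻ x, EReal.exp (φ x)) ≤ J := by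
    refine lintegral_mono fun x => ?_
    rw [← EReal.exp_coe]
    exact EReal.exp_monotone (hup x)
  have hIφ : (∫⁻ x, EReal.exp (φ x)) ≠ ⊤ := ne_top_of_le_ne_top hJtop hIφJ
  refine ⟨g, hlip, hφg, hgup, hglow, hphi, hIg, ?_⟩
  -- pointwise bound
  have hpt : ∀ x, EReal.exp (g x : EReal) ≤
      ENNReal.ofReal (Real.exp (s * (a - K + 1))) * EReal.exp (φ (x0 + (1 - s) • (x - x0))) +
      ENNReal.ofReal (min (Real.exp (-T)) (Real.exp (a - b * ‖x‖))) := by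
    intro x
    rcases lt_or_ge (g x) (-T) with hlt | hge
    · refine le_trans ?_ le_add_self
      rw [EReal.exp_coe]
      exact ENNReal.ofReal_le_ofReal (le_min (Real.exp_le_exp.2 hlt.le) (Real.exp_le_exp.2 (hgup x)))
    · refine le_trans ?_ le_self_add
      obtain ⟨y, p, hp, h1⟩ := R2 x hs0
      have hpa : p ≤ a := by have := ha y; rw [hp] at this; exact_mod_cast this
      have h2 : ‖x - y‖ ≤ s * η := by
        have h3 : Λ * ‖x - y‖ ≤ Λ * (s * η) := by
          have : (a + T + 1) ≤ Λ * (s * η) := by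
            rwa [div_le_iff₀ (by positivity)] at hΛs
          linarith
        exact le_of_mul_le_mul_left h3 hΛpos
      have hw : x0 + ((1 - s) / s) • (x - y) ∈ Metric.closedBall x0 η := by
        rw [Metric.mem_closedBall, dist_eq_norm, add_sub_cancel_left, norm_smul, Real.norm_eq_abs,
          abs_of_pos (div_pos (by linarith) hs0), div_mul_eq_mul_div, div_le_iff₀ hs0]
        have : (1 - s) * ‖x - y‖ ≤ 1 * ‖x - y‖ := by gcongr; linarith
        linarith
      have h3 := h.level hp.ge (hlow _ hw) (by linarith : 0 ≤ 1 - s) hs0.le (by ring)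
      have e : (1 - s) • y + s • (x0 + ((1 - s) / s) • (x - y)) = x0 + (1 - s) • (x - x0) := by
        rw [smul_add, smul_smul, mul_div_cancel₀ _ hs0.ne']
        module
      rw [e] at h3
      have h4 : g x ≤ s * (a - K + 1) + ((1 - s) * p + s * K) := by
        have h5 : s * p ≤ s * a := by gcongr
        have : 0 ≤ Λ * ‖x - y‖ := by positivity
        linarith
      calc EReal.exp (g x : EReal) ≤ EReal.exp ((s * (a - K + 1) + ((1 - s) * p + s * K) : ℝ) : EReal) :=
            EReal.exp_monotone (by exact_mod_cast h4)
        _ = ENNReal.ofReal (Real.exp (s * (a - K + 1))) * EReal.exp (((1 - s) * p + s * K : ℝ) : EReal) := by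
            rw [EReal.coe_add, EReal.exp_add, EReal.exp_coe]
        _ ≤ _ := by gcongr
  have hIntg := lintegral_mono (μ := (volume : Measure (Eu d))) hpt
  rw [lintegral_add_right _ (by fun_prop), lintegral_const_mul' _ _ ENNReal.ofReal_ne_top,
    lintegral_dilate (fun x => EReal.exp (φ x)) x0 (by linarith : 1 - s ≠ 0)] at hIntg
  have hIntg2 : (∫⁻ x, EReal.exp (g x : EReal)) ≤
      ENNReal.ofReal (Real.exp (s * (a - K + 1))) * (ENNReal.ofReal |((1 - s) ^ d)⁻¹| *
        ∫⁻ x, EReal.exp (φ x)) + ENNReal.ofReal (δ / 2) := hIntg.trans (by gcongr)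
  have hint3 := ENNReal.toReal_mono (by finiteness) hIntg2
  rw [ENNReal.toReal_add (by finiteness) (by finiteness), ENNReal.toReal_mul, ENNReal.toReal_mul,
    ENNReal.toReal_ofReal (Real.exp_pos _).le, ENNReal.toReal_ofReal (abs_nonneg _),
    ENNReal.toReal_ofReal (by positivity)] at hint3
  have hIJ := ENNReal.toReal_mono hJtop hIφJ
  set I := (∫⁻ x, EReal.exp (φ x)).toReal with hI
  have hI0 : 0 ≤ I := ENNReal.toReal_nonneg
  set A := Real.exp (s * (a - K + 1)) * |((1 - s) ^ d)⁻¹| with hA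
  have h8 : (A - 1) * I ≤ δ / 2 := by
    rcases le_total 0 (A - 1) with hA1 | hA1
    · exact (mul_le_mul_of_nonneg_left hIJ hA1).trans hs
    · have := mul_nonpos_of_nonpos_of_nonneg hA1 hI0
      linarith
  rw [← mul_assoc, ← hA] at hint3
  linarith

lemma lip_bnorm {b : ℝ} (hb : 0 < b) :
    LipschitzWith b.toNNReal (fun x : Eu d => b * ‖x‖) := by
  refine LipschitzWith.of_dist_le_mul fun x y => ?_
  rw [Real.coe_toNNReal _ hb.le, Real.dist_eq, ← mul_sub, abs_mul, abs_of_pos hb, dist_eq_norm]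
  gcongr
  exact abs_norm_sub_norm_le x y

lemma lip_trunc {b : ℝ} (hb : 0 < b) (S : ℝ) :
    LipschitzWith b.toNNReal (fun x : Eu d => min (b * ‖x‖) S) := (lip_bnorm hb).min_const S

lemma abs_trunc {b S : ℝ} (hb : 0 < b) (hS : 0 ≤ S) (x : Eu d) : |min (b * ‖x‖) S| ≤ S := by
  rw [abs_of_nonneg (le_min (by positivity) hS)]
  exact min_le_right _ _

lemma int_of_bdd {P : Measure (Eu d)} [IsProbabilityMeasure P] {f : Eu d → ℝ} (hf : Continuous f)
    {C : ℝ} (hC : ∀ x, |f x| ≤ C) : Integrable f P :=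
  Integrable.of_bound hf.aestronglyMeasurable C (Eventually.of_forall hC)

lemma int_trunc {P : Measure (Eu d)} [IsProbabilityMeasure P] {b S : ℝ} (hb : 0 < b)
    (hS : 0 ≤ S) : Integrable (fun x : Eu d => min (b * ‖x‖) S) P :=
  int_of_bdd (lip_trunc hb S).continuous (abs_trunc hb hS)

lemma trunc_bound {P : Measure (Eu d)} [IsProbabilityMeasure P] {φ : Eu d → EReal} {a b c : ℝ}
    (hb : 0 < b) (hφ : ∀ x, φ x ≤ ((a - b * ‖x‖ : ℝ) : EReal)) (hc : (c : EReal) ≤ Lfun φ P)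
    {S : ℝ} (hS : 0 ≤ S) : ∫ x, min (b * ‖x‖) S ∂P ≤ a + 1 - c := by
  have hi := int_trunc (P := P) hb hS
  have h := (Lfun_bound (f := fun x => a - min (b * ‖x‖) S) hc ((integrable_const a).sub hi)
    (fun x => (hφ x).trans (by
      have := min_le_left (b * ‖x‖) S
      exact_mod_cast (by linarith : a - b * ‖x‖ ≤ a - min (b * ‖x‖) S)))).2
  rw [integral_sub (integrable_const a) hi] at h
  simp only [integral_const, probReal_univ, one_smul] at h
  have : 0 ≤ (∫⁻ x, EReal.exp (φ x)).toReal := ENNReal.toReal_nonneg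
  linarith

lemma integrable_of_trunc {P : Measure (Eu d)} [IsProbabilityMeasure P] {b M : ℝ} (hb : 0 < b)
    (h : ∀ S : ℕ, ∫ x, min (b * ‖x‖) S ∂P ≤ M) : Integrable (fun x : Eu d => ‖x‖) P := by
  have h1 : ∫⁻ x, ENNReal.ofReal (b * ‖x‖) ∂P ≤ ENNReal.ofReal M := by
    have h2 : ∀ x : Eu d, ENNReal.ofReal (b * ‖x‖) =
        ⨆ S : ℕ, ENNReal.ofReal (min (b * ‖x‖) S) := by
      intro x
      apply le_antisymm
      · obtain ⟨S, hS⟩ := exists_nat_ge (b * ‖x‖)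
        refine le_iSup_of_le S ?_
        rw [min_eq_left hS]
      · exact iSup_le fun S => ENNReal.ofReal_le_ofReal (min_le_left _ _)
    simp_rw [h2]
    rw [lintegral_iSup (fun S => by fun_prop)]
    · refine iSup_le fun S => ?_
      rw [← ofReal_integral_eq_lintegral_ofReal (int_trunc hb (Nat.cast_nonneg S))
        (Eventually.of_forall fun x => le_min (by positivity) (Nat.cast_nonneg S))]
      exact ENNReal.ofReal_le_ofReal (h S)
    · intro S S' hSS x
      apply ENNReal.ofReal_le_ofReal
      gcongr
  have h3 : Integrable (fun x : Eu d => b * ‖x‖) P := by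
    refine ⟨by fun_prop, ?_⟩
    rw [hasFiniteIntegral_iff_ofReal (Eventually.of_forall fun x => by positivity)]
    exact h1.trans_lt ENNReal.ofReal_lt_top
  have := h3.const_mul b⁻¹
  simpa [← mul_assoc, inv_mul_cancel₀ hb.ne'] using this

lemma m1_top_iff {P : Measure (Eu d)} :
    Integrable (fun x : Eu d => ‖x‖) P ↔ (∫⁻ x, (‖x‖₊ : ℝ≥0∞) ∂P) ≠ ⊤ := by
  rw [← lt_top_iff_ne_top]
  constructor
  · intro h
    have := h.2
    rw [hasFiniteIntegral_iff_norm] at this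
    simpa [enorm_eq_nnnorm] using this
  · intro h
    refine ⟨by fun_prop, ?_⟩
    rw [hasFiniteIntegral_iff_norm]
    simpa [enorm_eq_nnnorm] using h

lemma m1_eq {P : Measure (Eu d)} (h : Integrable (fun x : Eu d => ‖x‖) P) :
    (∫⁻ x, (‖x‖₊ : ℝ≥0∞) ∂P) = ENNReal.ofReal (∫ x, ‖x‖ ∂P) := by
  rw [ofReal_integral_eq_lintegral_ofReal h (Eventually.of_forall fun x => norm_nonneg x)]
  simp [enorm_eq_nnnorm]

lemma claimA {Qn : ℕ → Measure (Eu d)} {Q : Measure (Eu d)}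
    [∀ n, IsProbabilityMeasure (Qn n)] [IsProbabilityMeasure Q]
    (hQ : (interior (csupp Q)).Nonempty) (hw : WConv Qn Q)
    (hm : ¬ Integrable (fun x : Eu d => ‖x‖) Q) (c : ℝ) :
    ∀ᶠ n in atTop, Lprof (Qn n) ≤ (c : EReal) := by
  obtain ⟨x0, η, hη, hη1, hND⟩ := exists_ND hQ hw
  obtain ⟨a, b, K, hb, hcore⟩ := core_fixed x0 hη hη1 c
  obtain ⟨S, hS⟩ : ∃ S : ℕ, a + 2 - c < ∫ x, min (b * ‖x‖) S ∂Q := by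
    by_contra! h
    exact hm (integrable_of_trunc hb h)
  have hlip : LipschitzWith b.toNNReal (fun x : Eu d => - min (b * ‖x‖) S) := (lip_trunc hb S).neg
  filter_upwards [hND, hw.uniform_BL b.toNNReal S one_pos] with n hn hBL
  by_contra! hlt
  obtain ⟨φ, hφ, hc⟩ := exists_of_lt_Lprof hlt
  have h1 := trunc_bound hb (hcore (Qn n) hn φ hφ hc.le).1 hc.le (Nat.cast_nonneg S)
  have h2 := hBL _ hlip (fun x => by rw [abs_neg]; exact abs_trunc hb (Nat.cast_nonneg S) x)
  rw [integral_neg, integral_neg] at h2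
  linarith

lemma WConv_const (Q : Measure (Eu d)) : WConv (fun _ => Q) Q := fun _ => tendsto_const_nhds

lemma exists_T {Q : Measure (Eu d)} [IsProbabilityMeasure Q] {h : Eu d → ℝ} (hi : Integrable h Q)
    {δ : ℝ} (hδ : 0 < δ) (T0 : ℝ) :
    ∃ T : ℝ, T0 ≤ T ∧ 0 ≤ T ∧ ∫ x, max (h x - T) 0 ∂Q ≤ δ := by
  have ht : Tendsto (fun n : ℕ => ∫ x, max (h x - n) 0 ∂Q) atTop (𝓝 (∫ x, (0:ℝ) ∂Q)) := by
    refine tendsto_integral_of_dominated_convergence (fun x => |h x|) (fun n => ?_) hi.abs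
      (fun n => Eventually.of_forall fun x => ?_) (Eventually.of_forall fun x => ?_)
    · exact ((hi.sub (integrable_const _)).pos_part).1
    · rw [Real.norm_eq_abs, abs_of_nonneg (le_max_right _ _)]
      have : (0:ℝ) ≤ n := Nat.cast_nonneg n
      exact max_le (by linarith [le_abs_self (h x)]) (abs_nonneg _)
    · refine tendsto_const_nhds.congr' ?_
      obtain ⟨N, hN⟩ := exists_nat_ge (h x)
      filter_upwards [eventually_ge_atTop N] with n hn
      have : (N:ℝ) ≤ n := by exact_mod_cast hn
      rw [max_eq_right]; linarith
  rw [integral_zero] at ht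
  obtain ⟨N, hN⟩ := exists_nat_ge T0
  obtain ⟨n, h1, h2⟩ := ((ht.eventually_lt_const hδ).and (eventually_ge_atTop N)).exists
  have : (N:ℝ) ≤ n := by exact_mod_cast h2
  exact ⟨n, hN.trans this, Nat.cast_nonneg n, h1.le⟩

lemma int_g {P : Measure (Eu d)} [IsProbabilityMeasure P]
    (hm : Integrable (fun x : Eu d => ‖x‖) P) {Λ : ℝ≥0} {g : Eu d → ℝ} (hg : LipschitzWith Λ g) :
    Integrable g P := by
  refine (((integrable_const |g 0|).add (hm.const_mul (Λ:ℝ)))).mono'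
    hg.continuous.aestronglyMeasurable (Eventually.of_forall fun x => ?_)
  have := hg.dist_le_mul x 0
  rw [Real.dist_eq, dist_zero_right] at this
  have h2 : |g x| ≤ |g x - g 0| + |g 0| := by simpa using abs_add_le (g x - g 0) (g 0)
  simp only [Pi.add_apply, Real.norm_eq_abs]
  linarith

lemma claimB {Qn : ℕ → Measure (Eu d)} {Q : Measure (Eu d)}
    [∀ n, IsProbabilityMeasure (Qn n)] [IsProbabilityMeasure Q]
    (hQ : (interior (csupp Q)).Nonempty) (hw : WConv Qn Q)
    (hm : Integrable (fun x : Eu d => ‖x‖) Q) (c0 : ℝ) :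
    ∃ b : ℝ, 0 < b ∧ ∀ δ : ℝ, 0 < δ → ∀ᶠ n in atTop, ∀ c : ℝ, c0 ≤ c →
      (c : EReal) < Lprof (Qn n) → Integrable (fun x : Eu d => ‖x‖) (Qn n) ∧
      ((c + b * max 0 (∫ x, ‖x‖ ∂(Qn n) - ∫ x, ‖x‖ ∂Q) - δ : ℝ) : EReal) ≤ Lprof Q := by
  obtain ⟨x0, η, hη, hη1, hND⟩ := exists_ND hQ hw
  obtain ⟨a, b, K, hb, hcore⟩ := core_fixed x0 hη hη1 c0
  refine ⟨b, hb, fun δ hδ => ?_⟩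
  obtain ⟨Λ, hΛ⟩ := reg_lemma x0 hη a hb K (δ := δ / 4) (by positivity)
  have hlipx : LipschitzWith 1 (fun x : Eu d => ‖x - x0‖) :=
    LipschitzWith.of_dist_le_mul fun x y => by
      simpa [Real.dist_eq, dist_eq_norm] using abs_norm_sub_norm_le (x - x0) (y - x0)
  have hhi : Integrable (fun x : Eu d => Λ * ‖x - x0‖ - K) Q :=
    ((int_g hm hlipx).const_mul _).sub (integrable_const K)
  obtain ⟨T, hTa, hT0, hT⟩ := exists_T hhi (δ := δ / 4) (by positivity) (-a)
  filter_upwards [hND, hw.uniform_BL Λ (max |a| T) (δ := δ / 4) (by positivity),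
    hw.uniform_BL b.toNNReal (a + T) (δ := δ / 4) (by positivity)] with n hn hBL1 hBL2
  intro c hc0 hlt
  obtain ⟨φ, hφ, hc⟩ := exists_of_lt_Lprof hlt
  have hc0' : (c0 : EReal) ≤ Lfun φ (Qn n) := le_trans (by exact_mod_cast hc0) hc.le
  obtain ⟨hup, hlo⟩ := hcore (Qn n) hn φ hφ hc0'
  have hmn : Integrable (fun x : Eu d => ‖x‖) (Qn n) :=
    integrable_of_trunc hb fun S => trunc_bound hb hup hc.le (Nat.cast_nonneg S)
  refine ⟨hmn, ?_⟩
  obtain ⟨g, hgL, hφg, hga, hgK, hgP, hge, hgE⟩ := hΛ φ hφ hup hlo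
  have hgn := int_g hmn hgL
  have hgQ := int_g hm hgL
  have hb1 := (Lfun_bound hc.le hgn hφg).2
  have hle : Lfun (fun x => (g x : EReal)) Q ≤ Lprof Q := le_Lprof hgP
  rw [Lfun_coe hgQ hge] at hle
  refine le_trans ?_ hle
  norm_cast
  have hmaxL : LipschitzWith Λ (fun x => max (g x) (-T)) := hgL.max_const (-T)
  have h1 := hBL1 _ hmaxL (fun x => by
    have h := hga x
    have : 0 ≤ b * ‖x‖ := by positivity
    rw [abs_le]
    constructor
    · linarith [le_max_right |a| T, le_max_right (g x) (-T)]
    · exact max_le (by linarith [le_abs_self a, le_max_left |a| T])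
        (by linarith [le_max_left |a| T, abs_nonneg a]))
  have h2 := hBL2 _ (lip_trunc hb (a + T)) (abs_trunc hb (by linarith))
  have h3 : ∫ x, max (g x) (-T) ∂Q ≤ ∫ x, g x ∂Q + δ / 4 := by
    calc ∫ x, max (g x) (-T) ∂Q ≤ ∫ x, (g x + max (Λ * ‖x - x0‖ - K - T) 0) ∂Q := by
          refine integral_mono (int_g hm hmaxL)
            (hgQ.add (hhi.sub (integrable_const T)).pos_part) fun x => ?_
          have := hgK x
          refine max_le (by linarith [le_max_right (Λ * ‖x - x0‖ - K - T) 0]) ?_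
          linarith [le_max_left (Λ * ‖x - x0‖ - K - T) 0]
      _ = ∫ x, g x ∂Q + ∫ x, max (Λ * ‖x - x0‖ - K - T) 0 ∂Q :=
          integral_add hgQ (hhi.sub (integrable_const T)).pos_part
      _ ≤ _ := by linarith
  have h4 : ∫ x, g x ∂(Qn n) ≤ ∫ x, max (g x) (-T) ∂(Qn n) :=
    integral_mono hgn (int_g hmn hmaxL) fun x => le_max_left _ _
  have hit : Integrable (fun x : Eu d => min (b * ‖x‖) (a + T)) (Qn n) :=
    int_trunc hb (by linarith)
  have hms : Integrable (fun x : Eu d => max (g x) (-T) - b * ‖x‖) (Qn n) :=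
    (int_g hmn hmaxL).sub (hmn.const_mul b)
  have h5 : ∫ x, g x ∂(Qn n) ≤ ∫ x, max (g x) (-T) ∂(Qn n) - b * ∫ x, ‖x‖ ∂(Qn n)
      + ∫ x, min (b * ‖x‖) (a + T) ∂(Qn n) := by
    rw [← integral_const_mul, ← integral_sub (int_g hmn hmaxL) (hmn.const_mul b),
      ← integral_add hms hit]
    refine integral_mono hgn (hms.add hit) fun x => ?_
    have := hga x
    simp only
    rcases min_cases (b * ‖x‖) (a + T) with ⟨h, _⟩ | ⟨h, _⟩
    · rw [h]; linarith [le_max_left (g x) (-T)]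
    · rw [h]; linarith [le_max_right (g x) (-T)]
  have h6 : ∫ x, min (b * ‖x‖) (a + T) ∂Q ≤ b * ∫ x, ‖x‖ ∂Q := by
    rw [← integral_const_mul]
    exact integral_mono (int_trunc hb (by linarith)) (hm.const_mul b) fun x => min_le_left _ _
  rcases max_cases 0 (∫ x, ‖x‖ ∂(Qn n) - ∫ x, ‖x‖ ∂Q) with ⟨h, _⟩ | ⟨h, _⟩
  · rw [h]; linarith
  · rw [h, mul_sub]; linarith

lemma Lprof_ne_top {Q : Measure (Eu d)} [IsProbabilityMeasure Q]
    (hQ : (interior (csupp Q)).Nonempty) : Lprof Q ≠ ⊤ := by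
  obtain ⟨x0, η, hη, hη1, hND⟩ := exists_ND hQ (WConv_const Q)
  obtain ⟨n, hn⟩ := hND.exists
  obtain ⟨a, b, K, hb, hcore⟩ := core_fixed x0 hη hη1 0
  intro htop
  have hlt : ((max 0 (a + 2) : ℝ) : EReal) < Lprof Q := by rw [htop]; exact EReal.coe_lt_top _
  obtain ⟨φ, hφ, hc⟩ := exists_of_lt_Lprof hlt
  have h0 : ((0:ℝ) : EReal) ≤ Lfun φ Q := le_trans (by exact_mod_cast le_max_left _ _) hc.le
  have h1 := trunc_bound hb (hcore Q hn φ hφ h0).1 hc.le (le_refl 0)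
  have h2 : 0 ≤ ∫ x, min (b * ‖x‖) 0 ∂Q := integral_nonneg fun x => le_min (by positivity) le_rfl
  linarith [le_max_right 0 (a + 2)]

lemma Lprof_ne_bot {Q : Measure (Eu d)} [IsProbabilityMeasure Q]
    (hm : Integrable (fun x : Eu d => ‖x‖) Q) : Lprof Q ≠ ⊥ := by
  have hP : IsPhi (fun x : Eu d => ((0 - 1 * ‖x‖ : ℝ) : EReal)) := by
    refine isPhi_of_real (by fun_prop) one_pos (fun x => le_rfl) fun x y s t hs ht hst => ?_
    have := norm_add_le (s • x) (t • y)
    rw [norm_smul, norm_smul, Real.norm_of_nonneg hs.le, Real.norm_of_nonneg ht.le] at this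
    linarith
  have he : (∫⁻ x : Eu d, EReal.exp ((0 - 1 * ‖x‖ : ℝ) : EReal)) ≠ ⊤ := by
    simp_rw [EReal.exp_coe]
    exact (integrable_exp_norm 0 one_pos).lintegral_lt_top.ne
  have h := le_Lprof (Q := Q) hP
  have hi : Integrable (fun x : Eu d => (0:ℝ) - 1 * ‖x‖) Q :=
    (integrable_const 0).sub (hm.const_mul 1)
  rw [Lfun_coe hi he] at h
  intro hb
  rw [hb] at h
  exact EReal.coe_ne_bot _ (le_bot_iff.1 h)

lemma claimC {Qn : ℕ → Measure (Eu d)} {Q : Measure (Eu d)}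
    [∀ n, IsProbabilityMeasure (Qn n)] [IsProbabilityMeasure Q]
    (hQ : (interior (csupp Q)).Nonempty) (hw : WConv Qn Q)
    (hm : Integrable (fun x : Eu d => ‖x‖) Q)
    (hlim : limsup (fun n => ∫⁻ x, (‖x‖₊ : ℝ≥0∞) ∂(Qn n)) atTop ≤ ∫⁻ x, (‖x‖₊ : ℝ≥0∞) ∂Q)
    {c δ : ℝ} (hδ : 0 < δ) (hc : (c : EReal) < Lprof Q) :
    ∀ᶠ n in atTop, ((c - δ : ℝ) : EReal) ≤ Lprof (Qn n) := by
  obtain ⟨x0, η, hη, hη1, hND⟩ := exists_ND hQ (WConv_const Q)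
  obtain ⟨k, hk⟩ := hND.exists
  obtain ⟨a, b, K, hb, hcore⟩ := core_fixed x0 hη hη1 c
  obtain ⟨Λ, hΛ⟩ := reg_lemma x0 hη a hb K (δ := δ / 3) (by positivity)
  obtain ⟨φ, hφ, hcφ⟩ := exists_of_lt_Lprof hc
  obtain ⟨hup, hlo⟩ := hcore Q hk φ hφ hcφ.le
  obtain ⟨g, hgL, hφg, hga, hgK, hgP, hge, hgE⟩ := hΛ φ hφ hup hlo
  have hgQ := int_g hm hgL
  have hb1 := (Lfun_bound hcφ.le hgQ hφg).2
  set C : ℝ := Λ * ‖x0‖ - K with hC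
  have hnn : 0 ≤ fun x : Eu d => g x + Λ * ‖x‖ + C := fun x => by
    have h1 := hgK x
    have h2 : (Λ:ℝ) * ‖x - x0‖ ≤ Λ * (‖x‖ + ‖x0‖) := by gcongr; exact norm_sub_le _ _
    simp only [Pi.zero_apply]
    linarith
  have hfi : ∀ P : Measure (Eu d), [IsProbabilityMeasure P] →
      Integrable (fun x : Eu d => ‖x‖) P → Integrable (fun x : Eu d => g x + Λ * ‖x‖ + C) P :=
    fun P _ h => ((int_g h hgL).add (h.const_mul _)).add (integrable_const C)
  have hfe : ∀ P : Measure (Eu d), [IsProbabilityMeasure P] →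
      Integrable (fun x : Eu d => ‖x‖) P → ∫ x, (g x + Λ * ‖x‖ + C) ∂P =
        ∫ x, g x ∂P + Λ * ∫ x, ‖x‖ ∂P + C := fun P _ h => by
    have hs : Integrable (fun x : Eu d => g x + Λ * ‖x‖) P := (int_g h hgL).add (h.const_mul _)
    rw [integral_add hs (integrable_const C),
      integral_add (int_g h hgL) (h.const_mul _), integral_const_mul]
    simp
  set m := ∫ x, ‖x‖ ∂Q with hmdef
  have hm0 : 0 ≤ m := integral_nonneg fun x => norm_nonneg x
  set κ := δ / (3 * (Λ + 1)) with hκ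
  have hκ0 : 0 < κ := by positivity
  have hκΛ : Λ * κ ≤ δ / 3 := by
    have : δ / 3 - Λ * κ = κ := by rw [hκ]; field_simp; ring
    linarith
  have e1 : ∀ᶠ n in atTop, (∫⁻ x, (‖x‖₊ : ℝ≥0∞) ∂(Qn n)) < ENNReal.ofReal (m + κ) := by
    refine eventually_lt_of_limsup_lt (hlim.trans_lt ?_)
    rw [m1_eq hm]
    exact ENNReal.ofReal_lt_ofReal_iff_of_nonneg hm0 |>.2 (by linarith)
  have e2 : ∀ᶠ n in atTop, Integrable (fun x : Eu d => ‖x‖) (Qn n) →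
      ∫ x, g x ∂Q + Λ * m + C - δ / 3 < ∫ x, (g x + Λ * ‖x‖ + C) ∂(Qn n) := by
    by_cases hneg : ∫ x, g x ∂Q + Λ * m + C - δ / 3 < 0
    · exact Eventually.of_forall fun n _ => hneg.trans_le (integral_nonneg hnn)
    push Not at hneg
    have hl := hw.lsc (f := fun x : Eu d => g x + Λ * ‖x‖ + C)
      ((hgL.continuous.add (continuous_const.mul continuous_norm)).add continuous_const) hnn
    rw [← ofReal_integral_eq_lintegral_ofReal (hfi Q hm) (Eventually.of_forall hnn),
      hfe Q hm] at hl
    have hlt : ENNReal.ofReal (∫ x, g x ∂Q + Λ * m + C - δ / 3) <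
        ENNReal.ofReal (∫ x, g x ∂Q + Λ * m + C) :=
      ENNReal.ofReal_lt_ofReal_iff_of_nonneg hneg |>.2 (by linarith)
    filter_upwards [eventually_lt_of_lt_liminf (hlt.trans_le hl)] with n hn hi
    rw [← ofReal_integral_eq_lintegral_ofReal (hfi (Qn n) hi) (Eventually.of_forall hnn)] at hn
    exact (ENNReal.ofReal_lt_ofReal_iff_of_nonneg hneg).1 hn
  filter_upwards [e1, e2] with n h1 h2
  have hi : Integrable (fun x : Eu d => ‖x‖) (Qn n) :=
    m1_top_iff.2 (h1.trans ENNReal.ofReal_lt_top).ne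
  have h3 := h2 hi
  rw [hfe _ hi] at h3
  rw [m1_eq hi, ENNReal.ofReal_lt_ofReal_iff (by linarith)] at h1
  have h4 : (Λ:ℝ) * ∫ x, ‖x‖ ∂(Qn n) ≤ Λ * (m + κ) := by gcongr
  have hle : Lfun (fun x => (g x : EReal)) (Qn n) ≤ Lprof (Qn n) := le_Lprof hgP
  rw [Lfun_coe (int_g hi hgL) hge] at hle
  refine le_trans ?_ hle
  norm_cast
  linarith

lemma part1 {Qn : ℕ → Measure (Eu d)} {Q : Measure (Eu d)}
    [∀ n, IsProbabilityMeasure (Qn n)] [IsProbabilityMeasure Q]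
    (hQ : (interior (csupp Q)).Nonempty) (hw : WConv Qn Q) :
    limsup (fun n => Lprof (Qn n)) atTop ≤ Lprof Q := by
  by_contra! h
  obtain ⟨c, h1, h2⟩ := EReal.lt_iff_exists_real_btwn.1 h
  by_cases hm : Integrable (fun x : Eu d => ‖x‖) Q
  · obtain ⟨c', h3, h4⟩ := EReal.lt_iff_exists_real_btwn.1 h1
    have h4' : c' < c := by exact_mod_cast h4
    obtain ⟨b, hb, hB⟩ := claimB hQ hw hm c
    have hf := frequently_lt_of_lt_limsup (by isBoundedDefault) h2
    obtain ⟨n, hn1, hn2⟩ := (hf.and_eventually (hB (c - c') (by linarith))).exists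
    have := (hn2 c le_rfl hn1).2
    have h5 : (c' : EReal) ≤ Lprof Q := le_trans (by
      have : 0 ≤ b * max 0 (∫ x, ‖x‖ ∂(Qn n) - ∫ x, ‖x‖ ∂Q) := by positivity
      exact_mod_cast (by linarith)) this
    exact absurd h3 (not_lt.2 h5)
  · have := limsup_le_of_le (by isBoundedDefault) (claimA hQ hw hm c)
    exact absurd h2 (not_lt.2 this)

lemma Lprof_eq_bot {Q : Measure (Eu d)} [IsProbabilityMeasure Q]
    (hQ : (interior (csupp Q)).Nonempty) (hm : ¬ Integrable (fun x : Eu d => ‖x‖) Q) :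
    Lprof Q = ⊥ := by
  rw [EReal.eq_bot_iff_forall_lt]
  intro c
  obtain ⟨n, hn⟩ := (claimA hQ (WConv_const Q) hm (c - 1)).exists
  exact lt_of_le_of_lt hn (by exact_mod_cast sub_one_lt c)

lemma part2 {Qn : ℕ → Measure (Eu d)} {Q : Measure (Eu d)}
    [∀ n, IsProbabilityMeasure (Qn n)] [IsProbabilityMeasure Q]
    (hQ : (interior (csupp Q)).Nonempty) (hw : WConv Qn Q)
    (h : (∫⁻ x, (‖x‖₊ : ℝ≥0∞) ∂Q) < limsup (fun n => ∫⁻ x, (‖x‖₊ : ℝ≥0∞) ∂(Qn n)) atTop) :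
    liminf (fun n => Lprof (Qn n)) atTop < Lprof Q := by
  have hm : Integrable (fun x : Eu d => ‖x‖) Q := m1_top_iff.2 (h.trans_le le_top).ne
  obtain ⟨ℓ, hℓ⟩ : ∃ ℓ : ℝ, Lprof Q = ℓ :=
    ⟨_, (EReal.coe_toReal (Lprof_ne_top hQ) (Lprof_ne_bot hm)).symm⟩
  obtain ⟨r, h1, h2⟩ := ENNReal.lt_iff_exists_nnreal_btwn.1 h
  have hr : ∫ x, ‖x‖ ∂Q < r := by
    rw [m1_eq hm, ← ENNReal.ofReal_coe_nnreal,
      ENNReal.ofReal_lt_ofReal_iff_of_nonneg (integral_nonneg fun x => norm_nonneg x)] at h1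
    exact h1
  set m := ∫ x, ‖x‖ ∂Q with hmdef
  obtain ⟨b, hb, hB⟩ := claimB hQ hw hm (ℓ - 1)
  set θ := b * (r - m) with hθ
  have hθ0 : 0 < θ := mul_pos hb (by linarith)
  have hf := frequently_lt_of_lt_limsup (by isBoundedDefault) h2
  have key : ∃ᶠ n in atTop, Lprof (Qn n) ≤ ((max (ℓ - 1) (ℓ - θ / 2) : ℝ) : EReal) := by
    refine (hf.and_eventually (hB (θ / 4) (by linarith))).mono ?_
    rintro n ⟨hn1, hn2⟩
    by_contra! hlt
    obtain ⟨hi, hle⟩ := hn2 _ (le_max_left _ _) hlt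
    rw [hℓ] at hle
    have hle' := EReal.coe_le_coe_iff.1 hle
    rw [m1_eq hi, ← ENNReal.ofReal_coe_nnreal] at hn1
    replace hn1 : (r:ℝ) < ∫ x, ‖x‖ ∂(Qn n) := (ENNReal.ofReal_lt_ofReal_iff_of_nonneg r.2).1 hn1
    have h3 : θ ≤ b * max 0 (∫ x, ‖x‖ ∂(Qn n) - m) := by
      rw [hθ]; gcongr
      exact le_max_of_le_right (by linarith)
    linarith [le_max_right (ℓ - 1) (ℓ - θ / 2)]
  refine (liminf_le_of_frequently_le key (by isBoundedDefault)).trans_lt ?_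
  rw [hℓ]
  exact_mod_cast max_lt (by linarith) (by linarith)

lemma part3 {Qn : ℕ → Measure (Eu d)} {Q : Measure (Eu d)}
    [∀ n, IsProbabilityMeasure (Qn n)] [IsProbabilityMeasure Q]
    (hQ : (interior (csupp Q)).Nonempty) (hw : WConv Qn Q)
    (h : liminf (fun n => Lprof (Qn n)) atTop < Lprof Q) :
    (∫⁻ x, (‖x‖₊ : ℝ≥0∞) ∂Q) < limsup (fun n => ∫⁻ x, (‖x‖₊ : ℝ≥0∞) ∂(Qn n)) atTop := by
  by_contra! hlim
  by_cases hm : Integrable (fun x : Eu d => ‖x‖) Q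
  · obtain ⟨c', h1, h2⟩ := EReal.lt_iff_exists_real_btwn.1 h
    obtain ⟨c, h3, h4⟩ := EReal.lt_iff_exists_real_btwn.1 h2
    have h3' : c' < c := by exact_mod_cast h3
    have := claimC hQ hw hm hlim (c := c) (δ := c - c') (by linarith) h4
    rw [sub_sub_cancel] at this
    exact absurd h1 (not_lt.2 (le_liminf_of_le (by isBoundedDefault) this))
  · rw [Lprof_eq_bot hQ hm] at h
    exact absurd h not_lt_bot

theorem main_thm {d : ℕ}
    (Qn : ℕ → Measure (EuclideanSpace ℝ (Fin d))) (Q : Measure (EuclideanSpace ℝ (Fin d)))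
    [∀ n, IsProbabilityMeasure (Qn n)] [IsProbabilityMeasure Q]
    (hQ : (interior (csupp Q)).Nonempty)
    (hw : WConv Qn Q) :
    Filter.limsup (fun n => Lprof (Qn n)) atTop ≤ Lprof Q ∧
    (Filter.liminf (fun n => Lprof (Qn n)) atTop < Lprof Q ↔
      (∫⁻ x, (‖x‖₊ : ℝ≥0∞) ∂Q) <
        Filter.limsup (fun n => ∫⁻ x, (‖x‖₊ : ℝ≥0∞) ∂(Qn n)) atTop) :=
  ⟨part1 hQ hw, part3 hQ hw, part2 hQ hw⟩

end Aux

/-- **Theorem 3 (weak upper semicontinuity).** If `Q_n →_w Q` with all convex supports having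
nonempty interior, then `limsup L(Q_n) ≤ L(Q)`, and `liminf L(Q_n) < L(Q)` iff
`limsup ∫‖x‖ dQ_n > ∫‖x‖ dQ`. -/
theorem Lprof_weak_upper_semicontinuous {d : ℕ}
    (Qn : ℕ → Measure (EuclideanSpace ℝ (Fin d))) (Q : Measure (EuclideanSpace ℝ (Fin d)))
    [∀ n, IsProbabilityMeasure (Qn n)] [IsProbabilityMeasure Q]
    (hQn : ∀ n, (interior (csupp (Qn n))).Nonempty) (hQ : (interior (csupp Q)).Nonempty)
    (hw : WConv Qn Q) :
    Filter.limsup (fun n => Lprof (Qn n)) atTop ≤ Lprof Q ∧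
    (Filter.liminf (fun n => Lprof (Qn n)) atTop < Lprof Q ↔
      (∫⁻ x, (‖x‖₊ : ℝ≥0∞) ∂Q) <
        Filter.limsup (fun n => ∫⁻ x, (‖x‖₊ : ℝ≥0∞) ∂(Qn n)) atTop) := by
  exact main_thm Qn Q hQ hw
end
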